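/- arXiv:math/0606720 — 2 statements merged into one kernel-verified Lean document; each statement's English description precedes it below -/
import Mathlib

section
/- Let (R, m) be a complete Noetherian local ring, M a finite R-module of Krull dimension n ≥ 1, and a an ideal of R. Then Att_R(H^n_a(M)) = {p ∈ Assh_R(M) : a + p is m-primary}, i.e., a prime p ∈ Assh_R(M) is an attached prime of H^n_a(M) if and only if the radical of a + p equals m. -/
/-!
STATEMENT 10 (cf. [DY1, Theorem A] combined with the Lichtenbaum–Hartshorne theorem):
for a complete Noetherian local ring `(R, m)` and a finite module `M` of dimension
`n ≥ 1`, `Att_R(H^n_a(M)) = { p ∈ Assh_R(M) | a + p is m-primary }`.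
-/

open CategoryTheory

noncomputable section

universe u

/-- A prime ideal `p` is an *attached prime* of the `R`-module `N` if `p` is the annihilator
of some quotient of `N`. -/
def attachedPrimes (R : Type u) [CommRing R] (N : Type u) [AddCommGroup N] [Module R N] :
    Set (Ideal R) :=
  { p | p.IsPrime ∧ ∃ K : Submodule R N, p = Module.annihilator R (N ⧸ K) }

/-- `Assh_R(M)`: the associated primes `p` of `M` with `dim (R ⧸ p) = dim M`, where the
dimension of `M` is recorded by the natural number `n`. -/
def assh (R : Type u) [CommRing R] (M : Type u) [AddCommGroup M] [Module R M] (n : ℕ) :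
    Set (Ideal R) :=
  { p ∈ associatedPrimes R M | ringKrullDim (R ⧸ p) = (n : WithBot (WithTop ℕ)) }

noncomputable section
open CategoryTheory CategoryTheory.Limits


namespace LCaux

section Derived
variable {C : Type*} [Category* C] [Abelian C] [HasProjectiveResolutions C] 
  {D : Type*} [Category* D] [Abelian D]
  {F₁ F₂ F₃ : C ⥤ D} [F₁.Additive] [F₂.Additive] [F₃.Additive]

lemma wapp {α : F₁ ⟶ F₂} {β : F₂ ⟶ F₃} (w : α ≫ β = 0) (X : C) : α.app X ≫ β.app X = 0 := by
  rw [← NatTrans.comp_app, w]; rfl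

/-- the short complex of chain complexes -/
def dsc (α : F₁ ⟶ F₂) (β : F₂ ⟶ F₃) (w : α ≫ β = 0) (K : ChainComplex C ℕ) :
    ShortComplex (ChainComplex D ℕ) :=
  ShortComplex.mk ((NatTrans.mapHomologicalComplex α _).app K)
    ((NatTrans.mapHomologicalComplex β _).app K) (by
      ext i
      exact wapp w (K.X i))

lemma dsc_shortExact (α : F₁ ⟶ F₂) (β : F₂ ⟶ F₃) (w : α ≫ β = 0) (K : ChainComplex C ℕ)
    (h : ∀ i, (ShortComplex.mk (α.app (K.X i)) (β.app (K.X i)) (wapp w _)).ShortExact) :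
    (dsc α β w K).ShortExact := by
  apply HomologicalComplex.shortExact_of_degreewise_shortExact
  intro i
  exact h i

def dscMap (α : F₁ ⟶ F₂) (β : F₂ ⟶ F₃) (w : α ≫ β = 0) {K L : ChainComplex C ℕ} (φ : K ⟶ L) :
    dsc α β w K ⟶ dsc α β w L where
  τ₁ := (F₁.mapHomologicalComplex _).map φ
  τ₂ := (F₂.mapHomologicalComplex _).map φ
  τ₃ := (F₃.mapHomologicalComplex _).map φ
  comm₁₂ := ((NatTrans.mapHomologicalComplex α _).naturality φ)
  comm₂₃ := ((NatTrans.mapHomologicalComplex β _).naturality φ)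

/-- short exactness on projectives -/
def SEP (α : F₁ ⟶ F₂) (β : F₂ ⟶ F₃) (w : α ≫ β = 0) : Prop :=
  ∀ (P : C) [Projective P], (ShortComplex.mk (α.app P) (β.app P) (wapp w P)).ShortExact

lemma dsc_se {α : F₁ ⟶ F₂} {β : F₂ ⟶ F₃} {w : α ≫ β = 0} (h : SEP α β w)
    {X : C} (P : ProjectiveResolution X) : (dsc α β w P.complex).ShortExact :=
  dsc_shortExact α β w _ (fun i => h (P.complex.X i))

/-- homology of functor applied to complex -/
abbrev HF (F : C ⥤ D) [F.Additive] (n : ℕ) (K : ChainComplex C ℕ) : D :=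
  (HomologicalComplex.homologyFunctor D (ComplexShape.down ℕ) n).obj ((F.mapHomologicalComplex _).obj K)

abbrev HFm (F : C ⥤ D) [F.Additive] (n : ℕ) {K L : ChainComplex C ℕ} (φ : K ⟶ L) : HF F n K ⟶ HF F n L :=
  (HomologicalComplex.homologyFunctor D (ComplexShape.down ℕ) n).map ((F.mapHomologicalComplex _).map φ)

abbrev HFt (α : F₁ ⟶ F₂) (n : ℕ) (K : ChainComplex C ℕ) : HF F₁ n K ⟶ HF F₂ n K :=
  (HomologicalComplex.homologyFunctor D (ComplexShape.down ℕ) n).map ((NatTrans.mapHomologicalComplex α _).app K)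

def hδ {α : F₁ ⟶ F₂} {β : F₂ ⟶ F₃} {w : α ≫ β = 0} (h : SEP α β w)
    {X : C} (P : ProjectiveResolution X) (n : ℕ) : HF F₃ (n+1) P.complex ⟶ HF F₁ n P.complex :=
  (dsc_se h P).δ (n+1) n (by simp)

lemma hδ_nat {α : F₁ ⟶ F₂} {β : F₂ ⟶ F₃} {w : α ≫ β = 0} (h : SEP α β w)
    {X Y : C} (P : ProjectiveResolution X) (Q : ProjectiveResolution Y)
    (φ : P.complex ⟶ Q.complex) (n : ℕ) :
    HFm F₃ (n+1) φ ≫ hδ h Q n = hδ h P n ≫ HFm F₁ n φ :=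
  (HomologicalComplex.HomologySequence.δ_naturality (dscMap α β w φ) (dsc_se h P)
      (dsc_se h Q) (n+1) n (by simp)).symm

lemma hzero₂ {α : F₁ ⟶ F₂} {β : F₂ ⟶ F₃} (w : α ≫ β = 0)
    (K : ChainComplex C ℕ) (n : ℕ) : HFt α n K ≫ HFt β n K = 0 := by
  have := (dsc α β w K).zero
  rw [← Functor.map_comp]
  exact (congrArg _ this).trans (Functor.map_zero _ _ _)

lemma hzero₃ {α : F₁ ⟶ F₂} {β : F₂ ⟶ F₃} {w : α ≫ β = 0} (h : SEP α β w)
    {X : C} (P : ProjectiveResolution X) (n : ℕ) : HFt β (n+1) P.complex ≫ hδ h P n = 0 :=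
  (dsc_se h P).comp_δ (n+1) n (by simp)

lemma hzero₁ {α : F₁ ⟶ F₂} {β : F₂ ⟶ F₃} {w : α ≫ β = 0} (h : SEP α β w)
    {X : C} (P : ProjectiveResolution X) (n : ℕ) : hδ h P n ≫ HFt α n P.complex = 0 :=
  (dsc_se h P).δ_comp (n+1) n (by simp)

lemma hexact₂ {α : F₁ ⟶ F₂} {β : F₂ ⟶ F₃} {w : α ≫ β = 0} (h : SEP α β w)
    {X : C} (P : ProjectiveResolution X) (n : ℕ) :
    (ShortComplex.mk (HFt α n P.complex) (HFt β n P.complex) (hzero₂ w _ _)).Exact :=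
  (dsc_se h P).homology_exact₂ n

lemma hexact₃ {α : F₁ ⟶ F₂} {β : F₂ ⟶ F₃} {w : α ≫ β = 0} (h : SEP α β w)
    {X : C} (P : ProjectiveResolution X) (n : ℕ) :
    (ShortComplex.mk (HFt β (n+1) P.complex) (hδ h P n) (hzero₃ h P n)).Exact :=
  (dsc_se h P).homology_exact₃ (n+1) n (by simp)

lemma hexact₁ {α : F₁ ⟶ F₂} {β : F₂ ⟶ F₃} {w : α ≫ β = 0} (h : SEP α β w)
    {X : C} (P : ProjectiveResolution X) (n : ℕ) :
    (ShortComplex.mk (hδ h P n) (HFt α n P.complex) (hzero₁ h P n)).Exact :=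
  (dsc_se h P).homology_exact₁ (n+1) n (by simp)

def dδ {α : F₁ ⟶ F₂} {β : F₂ ⟶ F₃} {w : α ≫ β = 0} (h : SEP α β w) (n : ℕ) :
    F₃.leftDerived (n+1) ⟶ F₁.leftDerived n where
  app X := ((projectiveResolution X).isoLeftDerivedObj F₃ (n+1)).hom ≫
    hδ h (projectiveResolution X) n ≫
    ((projectiveResolution X).isoLeftDerivedObj F₁ n).inv
  naturality X Y f := by
    have e := ProjectiveResolution.lift_commutes_zero f (projectiveResolution X)
      (projectiveResolution Y)
    rw [ProjectiveResolution.isoLeftDerivedObj_hom_naturality_assoc f _ _ _ e,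
      Category.assoc, Category.assoc, ProjectiveResolution.isoLeftDerivedObj_inv_naturality f _ _ _ e]
    congr 1
    have := hδ_nat h _ _ (ProjectiveResolution.lift f (projectiveResolution X)
      (projectiveResolution Y)) n
    exact (Category.assoc _ _ _).symm.trans ((congrArg (· ≫ _) this).trans (Category.assoc _ _ _))

lemma dexact₂ {α : F₁ ⟶ F₂} {β : F₂ ⟶ F₃} {w : α ≫ β = 0} (h : SEP α β w)
    (n : ℕ) (X : C) : ∃ z, (ShortComplex.mk ((NatTrans.leftDerived α n).app X)
    ((NatTrans.leftDerived β n).app X) z).Exact := by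
  let P := projectiveResolution X
  have z : (NatTrans.leftDerived α n).app X ≫ (NatTrans.leftDerived β n).app X = 0 := by
    rw [P.leftDerived_app_eq α, P.leftDerived_app_eq β]
    simp only [Category.assoc, Iso.inv_hom_id_assoc]
    rw [← Category.assoc (HFt α n P.complex), hzero₂ w]
    simp
  refine ⟨z, ?_⟩
  refine (ShortComplex.exact_iff_of_iso (ShortComplex.isoMk (P.isoLeftDerivedObj F₁ n)
    (P.isoLeftDerivedObj F₂ n) (P.isoLeftDerivedObj F₃ n) ?_ ?_)).2 (hexact₂ h P n)
  · dsimp only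
    rw [P.leftDerived_app_eq α]
    simp only [Category.assoc, Iso.inv_hom_id, Category.comp_id]
  · dsimp only
    rw [P.leftDerived_app_eq β]
    simp only [Category.assoc, Iso.inv_hom_id, Category.comp_id]

lemma dexact₃ {α : F₁ ⟶ F₂} {β : F₂ ⟶ F₃} {w : α ≫ β = 0} (h : SEP α β w)
    (n : ℕ) (X : C) : ∃ z, (ShortComplex.mk ((NatTrans.leftDerived β (n+1)).app X)
    ((dδ h n).app X) z).Exact := by
  have z : (NatTrans.leftDerived β (n+1)).app X ≫ (dδ h n).app X = 0 := by
    rw [(projectiveResolution X).leftDerived_app_eq β]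
    dsimp only [dδ]
    simp only [Category.assoc, Iso.inv_hom_id_assoc]
    rw [← Category.assoc (HFt β _ _), hzero₃ h]
    simp
  refine ⟨z, ?_⟩
  refine (ShortComplex.exact_iff_of_iso (ShortComplex.isoMk
    ((projectiveResolution X).isoLeftDerivedObj F₂ (n+1))
    ((projectiveResolution X).isoLeftDerivedObj F₃ (n+1))
    ((projectiveResolution X).isoLeftDerivedObj F₁ n) ?_ ?_)).2 (hexact₃ h (projectiveResolution X) n)
  · dsimp only
    rw [(projectiveResolution X).leftDerived_app_eq β]
    simp only [Category.assoc, Iso.inv_hom_id, Category.comp_id]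
  · dsimp only [dδ]
    simp

lemma dexact₁ {α : F₁ ⟶ F₂} {β : F₂ ⟶ F₃} {w : α ≫ β = 0} (h : SEP α β w)
    (n : ℕ) (X : C) : ∃ z, (ShortComplex.mk ((dδ h n).app X)
    ((NatTrans.leftDerived α n).app X) z).Exact := by
  have z : (dδ h n).app X ≫ (NatTrans.leftDerived α n).app X = 0 := by
    rw [(projectiveResolution X).leftDerived_app_eq α]
    dsimp only [dδ]
    simp only [Category.assoc, Iso.inv_hom_id_assoc]
    rw [← Category.assoc (hδ h _ _), hzero₁ h]
    simp
  refine ⟨z, ?_⟩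
  refine (ShortComplex.exact_iff_of_iso (ShortComplex.isoMk
    ((projectiveResolution X).isoLeftDerivedObj F₃ (n+1))
    ((projectiveResolution X).isoLeftDerivedObj F₁ n)
    ((projectiveResolution X).isoLeftDerivedObj F₂ n) ?_ ?_)).2 (hexact₁ h (projectiveResolution X) n)
  · dsimp only [dδ]
    simp
  · dsimp only
    rw [(projectiveResolution X).leftDerived_app_eq α]
    simp only [Category.assoc, Iso.inv_hom_id, Category.comp_id]
end Derived
end LCaux
end

noncomputable section
open CategoryTheory CategoryTheory.Limits Opposite


namespace LCaux

section ExtSec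
variable {R : Type u} [CommRing R]

abbrev FY (Y : ModuleCat.{u} R) : ModuleCat.{u} R ⥤ (ModuleCat.{u} R)ᵒᵖ :=
  ((linearYoneda R (ModuleCat.{u} R)).obj Y).rightOp

abbrev FYm {Y Z : ModuleCat.{u} R} (f : Y ⟶ Z) : FY Z ⟶ FY Y :=
  NatTrans.rightOp ((linearYoneda R (ModuleCat.{u} R)).map f)

lemma FYw (S : ShortComplex (ModuleCat.{u} R)) : FYm S.g ≫ FYm S.f = 0 := by
  have : (linearYoneda R (ModuleCat.{u} R)).map S.f ≫ (linearYoneda R (ModuleCat.{u} R)).map S.g = 0 := by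
    rw [← Functor.map_comp, S.zero]
    ext X x
    exact (Limits.comp_zero : (show unop X ⟶ S.X₁ from x) ≫ (0: S.X₁ ⟶ S.X₃) = 0)
  ext X
  have h2 := congrArg (fun t => (t.app (op X)).op) this
  exact h2

lemma FY_sep (S : ShortComplex (ModuleCat.{u} R)) (hS : S.ShortExact) :
    SEP (FYm S.g) (FYm S.f) (FYw S) := by
  intro P hP
  have z : ((linearYoneda R (ModuleCat.{u} R)).map S.f).app (op P) ≫
      ((linearYoneda R (ModuleCat.{u} R)).map S.g).app (op P) = 0 :=
    congrArg Quiver.Hom.unop (wapp (FYw S) P)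
  have : (ShortComplex.mk (((linearYoneda R (ModuleCat.{u} R)).map S.f).app (op P))
    (((linearYoneda R (ModuleCat.{u} R)).map S.g).app (op P)) z).ShortExact := by
    have := hS.mono_f
    have := hS.epi_g
    refine ShortComplex.ShortExact.mk' ?_ ?_ ?_
    · rw [ShortComplex.moduleCat_exact_iff]
      intro x hx
      change P ⟶ S.X₂ at x
      have hx' : x ≫ S.g = 0 := hx
      exact ⟨hS.exact.lift x hx', hS.exact.lift_f x hx'⟩
    · rw [ModuleCat.mono_iff_injective]
      intro x y hxy
      change P ⟶ S.X₁ at x y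
      have : x ≫ S.f = y ≫ S.f := hxy
      exact (cancel_mono S.f).1 this
    · rw [ModuleCat.epi_iff_surjective]
      intro x
      change P ⟶ S.X₃ at x
      exact ⟨Projective.factorThru x S.g, Projective.factorThru_comp x S.g⟩
  exact this.op

abbrev EX (n : ℕ) (X Y : ModuleCat.{u} R) : ModuleCat.{u} R :=
  ((Ext R (ModuleCat.{u} R) n).obj (op X)).obj Y

def eδ {S : ShortComplex (ModuleCat.{u} R)} (hS : S.ShortExact) (n : ℕ) (X : ModuleCat.{u} R) :
    EX n X S.X₃ ⟶ EX (n+1) X S.X₁ :=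
  ((dδ (FY_sep S hS) n).app X).unop

lemma eδ_nat {S : ShortComplex (ModuleCat.{u} R)} (hS : S.ShortExact) (n : ℕ) {X X' : ModuleCat.{u} R}
    (f : X ⟶ X') : ((Ext R (ModuleCat.{u} R) n).map f.op).app S.X₃ ≫ eδ hS n X =
      eδ hS n X' ≫ ((Ext R (ModuleCat.{u} R) (n+1)).map f.op).app S.X₁ := 
  congrArg Quiver.Hom.unop ((dδ (FY_sep S hS) n).naturality f).symm

lemma exact_unop_fun {A B C : ModuleCat.{u} R} (f : A ⟶ B) (g : B ⟶ C) 
    (h : ∃ z, (ShortComplex.mk g.op f.op z).Exact) : Function.Exact f g := by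
  obtain ⟨z, h⟩ := h
  have := h.unop
  exact (ShortComplex.ShortExact.moduleCat_exact_iff_function_exact _).1 this

lemma eexact₂ {S : ShortComplex (ModuleCat.{u} R)} (hS : S.ShortExact) (n : ℕ) (X : ModuleCat.{u} R) :
    Function.Exact (((Ext R (ModuleCat.{u} R) n).obj (op X)).map S.f)
     (((Ext R (ModuleCat.{u} R) n).obj (op X)).map S.g) :=
  exact_unop_fun _ _ (dexact₂ (FY_sep S hS) n X)

lemma eexact₃ {S : ShortComplex (ModuleCat.{u} R)} (hS : S.ShortExact) (n : ℕ) (X : ModuleCat.{u} R) :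
    Function.Exact (((Ext R (ModuleCat.{u} R) n).obj (op X)).map S.g)
     (eδ hS n X) :=
  exact_unop_fun _ _ (dexact₁ (FY_sep S hS) n X)

lemma eexact₁ {S : ShortComplex (ModuleCat.{u} R)} (hS : S.ShortExact) (n : ℕ) (X : ModuleCat.{u} R) :
    Function.Exact (eδ hS n X) (((Ext R (ModuleCat.{u} R) (n+1)).obj (op X)).map S.f) :=
  exact_unop_fun _ _ (dexact₃ (FY_sep S hS) n X)

end ExtSec
end LCaux
end

noncomputable section
open CategoryTheory CategoryTheory.Limits Opposite


namespace LCaux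

section Lin
variable {R : Type u} [CommRing R]

instance opLin : Linear R (ModuleCat.{u} R)ᵒᵖ where
  homModule X Y :=
    { smul := fun r f => (r • f.unop).op
      one_smul := fun f => by
        change ((1:R) • f.unop).op = f; rw [one_smul]; rfl
      mul_smul := fun r s f => by
        change ((r * s) • f.unop).op = (r • (s • f.unop)).op; rw [mul_smul]
      smul_zero := fun r => by
        change (r • (0 : unop Y ⟶ unop X)).op = 0; rw [smul_zero]; rfl
      smul_add := fun r f g => by
        change (r • (f.unop + g.unop)).op = (r • f.unop).op + (r • g.unop).op
        rw [smul_add]; rfl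
      add_smul := fun r s f => by
        change ((r + s) • f.unop).op = (r • f.unop).op + (s • f.unop).op
        rw [add_smul]; rfl
      zero_smul := fun f => by
        change ((0:R) • f.unop).op = 0
        rw [zero_smul]; rfl }
  smul_comp X Y Z r f g := by
    change (g.unop ≫ (r • f.unop)).op = (r • (g.unop ≫ f.unop)).op
    rw [Linear.comp_smul]
  comp_smul X Y Z f r g := by
    change ((r • g.unop) ≫ f.unop).op = (r • (g.unop ≫ f.unop)).op
    rw [Linear.smul_comp]

lemma op_smul' {X Y : ModuleCat.{u} R} (r : R) (f : X ⟶ Y) : (r • f).op = r • f.op := rfl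

lemma hmap_smul {D : Type*} [Category* D] [Abelian D] [Linear R D] {K L : ChainComplex D ℕ}
    (r : R) (φ : K ⟶ L) (n : ℕ) :
    (HomologicalComplex.homologyFunctor D (ComplexShape.down ℕ) n).map (r • φ) =
      r • (HomologicalComplex.homologyFunctor D (ComplexShape.down ℕ) n).map φ :=
  ShortComplex.homologyMap_smul ((HomologicalComplex.shortComplexFunctor D _ n).map φ) r

lemma FY_lin (Y : ModuleCat.{u} R) {A B : ModuleCat.{u} R} (f : A ⟶ B) (r : R) :
    (FY Y).map (r • f) = r • (FY Y).map f := by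
  apply Quiver.Hom.unop_inj
  ext x
  change B ⟶ Y at x
  exact Linear.smul_comp _ _ _ r f x

lemma FYm_smul {Y Z : ModuleCat.{u} R} (f : Y ⟶ Z) (r : R) (A : ModuleCat.{u} R) :
    (FYm (r • f)).app A = r • (FYm f).app A := by
  apply Quiver.Hom.unop_inj
  ext x
  change A ⟶ Y at x
  exact Linear.comp_smul _ _ _ x r f

lemma FYm_add {Y Z : ModuleCat.{u} R} (f g : Y ⟶ Z) (A : ModuleCat.{u} R) :
    (FYm (f + g)).app A = (FYm f).app A + (FYm g).app A := by
  apply Quiver.Hom.unop_inj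
  ext x
  change A ⟶ Y at x
  exact Preadditive.comp_add _ _ _ x f g

lemma ext_map_smul (n : ℕ) (X : ModuleCat.{u} R) {Y Z : ModuleCat.{u} R} (f : Y ⟶ Z) (r : R) :
    ((Ext R (ModuleCat.{u} R) n).obj (op X)).map (r • f) =
      r • ((Ext R (ModuleCat.{u} R) n).obj (op X)).map f := by
  have : (NatTrans.leftDerived (FYm (r • f)) n).app X = r • (NatTrans.leftDerived (FYm f) n).app X := by
    rw [(projectiveResolution X).leftDerived_app_eq, (projectiveResolution X).leftDerived_app_eq]
    have e : (NatTrans.mapHomologicalComplex (FYm (r • f)) (ComplexShape.down ℕ)).app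
        (projectiveResolution X).complex = r • (NatTrans.mapHomologicalComplex (FYm f) 
        (ComplexShape.down ℕ)).app (projectiveResolution X).complex := by
      ext i
      exact FYm_smul f r _
    rw [e, hmap_smul, Linear.smul_comp, Linear.comp_smul]
  exact congrArg Quiver.Hom.unop this

lemma ext_map_add (n : ℕ) (X : ModuleCat.{u} R) {Y Z : ModuleCat.{u} R} (f g : Y ⟶ Z) :
    ((Ext R (ModuleCat.{u} R) n).obj (op X)).map (f + g) =
     ((Ext R (ModuleCat.{u} R) n).obj (op X)).map f + ((Ext R (ModuleCat.{u} R) n).obj (op X)).map g := by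
  have : (NatTrans.leftDerived (FYm (f + g)) n).app X =
    (NatTrans.leftDerived (FYm f) n).app X + (NatTrans.leftDerived (FYm g) n).app X := by
    rw [(projectiveResolution X).leftDerived_app_eq, (projectiveResolution X).leftDerived_app_eq,
      (projectiveResolution X).leftDerived_app_eq]
    have e : (NatTrans.mapHomologicalComplex (FYm (f + g)) (ComplexShape.down ℕ)).app
        (projectiveResolution X).complex = (NatTrans.mapHomologicalComplex (FYm f) 
        (ComplexShape.down ℕ)).app (projectiveResolution X).complex + 
        (NatTrans.mapHomologicalComplex (FYm g) 
        (ComplexShape.down ℕ)).app (projectiveResolution X).complex := by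
      ext i
      exact FYm_add f g _
    rw [e, Functor.map_add, Preadditive.add_comp, Preadditive.comp_add]
  exact congrArg Quiver.Hom.unop this

lemma ext_smul_left (n : ℕ) (X Y : ModuleCat.{u} R) (r : R) :
    ((Ext R (ModuleCat.{u} R) n).map (r • 𝟙 X).op).app Y = r • 𝟙 _ := by
  have : ((FY Y).leftDerived n).map (r • 𝟙 X) = r • 𝟙 _ := by
    rw [(FY Y).leftDerived_map_eq n (r • 𝟙 X) (P := projectiveResolution X)
      (Q := projectiveResolution X) (r • 𝟙 _) (by 
        rw [Linear.smul_comp, Category.id_comp]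
        ext1
        simp only [HomologicalComplex.comp_f, HomologicalComplex.smul_f_apply, ChainComplex.single₀_map_f_zero]
        have := Linear.comp_smul _ _ _ ((projectiveResolution X).π.f 0) r (𝟙 X)
        exact (congrArg (r • ·) (Category.comp_id _).symm).trans this.symm)]
    have e : ((FY Y).mapHomologicalComplex (ComplexShape.down ℕ)).map 
       (r • 𝟙 (projectiveResolution X).complex) = r • 𝟙 _ := by
      ext i
      change (FY Y).map (r • 𝟙 _) = r • _
      rw [FY_lin]
      exact congrArg (r • ·) ((FY Y).map_id _)
    rw [Functor.comp_map, e, hmap_smul, CategoryTheory.Functor.map_id, Linear.smul_comp, Linear.comp_smul, Category.id_comp, Iso.hom_inv_id]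
  exact congrArg Quiver.Hom.unop this

lemma ext_killed (n : ℕ) (X Y : ModuleCat.{u} R) (r : R) (h : ∀ x : X, r • x = 0) (e : EX n X Y) :
    r • e = 0 := by
  have : (r • 𝟙 X) = (0 : R) • 𝟙 X := by
    ext x
    exact (h x).trans (zero_smul R x).symm
  have h2 := ext_smul_left n X Y r
  rw [this, ext_smul_left, zero_smul] at h2
  have := congrArg (fun t => t.hom e) h2
  exact this.symm

end Lin
end LCaux
end

noncomputable section
open CategoryTheory CategoryTheory.Limits Opposite


namespace LCaux

section Zero
variable {C : Type*} [Category* C] [Abelian C] [HasProjectiveResolutions C] 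
  {D : Type*} [Category* D] [Abelian D]

lemma from'_nat {F G : C ⥤ D} [F.Additive] [G.Additive] (α : F ⟶ G) {X : C} (P : ProjectiveResolution X) :
    HomologicalComplex.opcyclesMap ((NatTrans.mapHomologicalComplex α _).app P.complex) 0 ≫ 
     P.fromLeftDerivedZero' G = P.fromLeftDerivedZero' F ≫ α.app X := by
  rw [← cancel_epi (HomologicalComplex.pOpcycles _ _)]
  rw [HomologicalComplex.p_opcyclesMap_assoc, ProjectiveResolution.pOpcycles_comp_fromLeftDerivedZero',
    ProjectiveResolution.pOpcycles_comp_fromLeftDerivedZero'_assoc]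
  exact (α.naturality _).symm

def ι' {X : C} (P : ProjectiveResolution X) (F : C ⥤ D) [F.Additive] : HF F 0 P.complex ⟶ F.obj X :=
  (ChainComplex.isoHomologyι₀ _).hom ≫ P.fromLeftDerivedZero' F

lemma ι'_nat {F G : C ⥤ D} [F.Additive] [G.Additive] (α : F ⟶ G) {X : C} (P : ProjectiveResolution X) :
    HFt α 0 P.complex ≫ ι' P G = ι' P F ≫ α.app X := by
  have := HomologicalComplex.homologyι_naturality
    ((NatTrans.mapHomologicalComplex α (ComplexShape.down ℕ)).app P.complex) 0
  exact (Category.assoc _ _ _).symm.trans ((congrArg (· ≫ _) this).trans ((Category.assoc _ _ _).trans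
    ((congrArg (_ ≫ ·) (from'_nat α P)).trans (Category.assoc _ _ _).symm)))

lemma from_eq {X : C} (P : ProjectiveResolution X) (F : C ⥤ D) [F.Additive] :
    F.fromLeftDerivedZero.app X = (P.isoLeftDerivedObj F 0).hom ≫ ι' P F :=
  P.fromLeftDerivedZero_eq F

lemma from_nat {F G : C ⥤ D} [F.Additive] [G.Additive] (α : F ⟶ G) (X : C) : 
   (NatTrans.leftDerived α 0).app X ≫ G.fromLeftDerivedZero.app X = F.fromLeftDerivedZero.app X ≫ α.app X := by
  rw [(projectiveResolution X).leftDerived_app_eq, from_eq (projectiveResolution X),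
   from_eq (projectiveResolution X)]
  simp only [Category.assoc, Iso.inv_hom_id_assoc]
  rw [← ι'_nat]

end Zero

section Hom0
variable {R : Type u} [CommRing R]

instance (Y : ModuleCat.{u} R) : PreservesLimits ((linearYoneda R (ModuleCat.{u} R)).obj Y) :=
  have : PreservesLimits ((linearYoneda R (ModuleCat.{u} R)).obj Y ⋙ forget _) :=
    (inferInstance : PreservesLimits (yoneda.obj Y))
  preservesLimits_of_reflects_of_preserves _ (forget _)

instance (Y : ModuleCat.{u} R) : PreservesFiniteColimits (FY Y) := 
  preservesFiniteColimits_rightOp _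

def e0 (X Y : ModuleCat.{u} R) : EX 0 X Y ≅ ((linearYoneda R (ModuleCat.{u} R)).obj Y).obj (op X) :=
  ((asIso ((FY Y).fromLeftDerivedZero.app X)).unop.symm : _ )

lemma e0_nat (X : ModuleCat.{u} R) {Y Z : ModuleCat.{u} R} (f : Y ⟶ Z) (x : EX 0 X Y) :
   (e0 X Z).hom (((Ext R (ModuleCat.{u} R) 0).obj (op X)).map f x) =
     ((e0 X Y).hom x : X ⟶ Y) ≫ f := by
  have h : ((linearYoneda R (ModuleCat.{u} R)).map f).app (op X) ≫ (e0 X Z).inv =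
      (e0 X Y).inv ≫ ((Ext R (ModuleCat.{u} R) 0).obj (op X)).map f := by
    have := congrArg Quiver.Hom.unop (from_nat (FYm f) X)
    exact this.symm
  rw [Iso.eq_inv_comp, ← Category.assoc, Iso.comp_inv_eq] at h
  exact (congrArg (fun t => t.hom x) h).symm

lemma e0_nat_left {X X' : ModuleCat.{u} R} (Y : ModuleCat.{u} R) (g : X ⟶ X') (x : EX 0 X' Y) :
   (e0 X Y).hom (((Ext R (ModuleCat.{u} R) 0).map g.op).app Y x) =
     g ≫ ((e0 X' Y).hom x : X' ⟶ Y) := by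
  have h : ((linearYoneda R (ModuleCat.{u} R)).obj Y).map g.op ≫ (e0 X Y).inv =
      (e0 X' Y).inv ≫ ((Ext R (ModuleCat.{u} R) 0).map g.op).app Y := by
    have := congrArg Quiver.Hom.unop ((FY Y).fromLeftDerivedZero.naturality g)
    exact this.symm
  rw [Iso.eq_inv_comp, ← Category.assoc, Iso.comp_inv_eq] at h
  exact (congrArg (fun t => t.hom x) h).symm

lemma ext_injective (n : ℕ) (X Y : ModuleCat.{u} R) [Injective Y] : IsZero (EX (n+1) X Y) := by
  refine IsZero.of_iso ?_ ((projectiveResolution X).isoExt (n + 1) Y)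
  rw [← HomologicalComplex.exactAt_iff_isZero_homology, HomologicalComplex.exactAt_iff' _ n (n+1) (n+2) (by simp) (by simp)]
  rw [ShortComplex.moduleCat_exact_iff]
  intro x hx
  change (projectiveResolution X).complex.X (n+1) ⟶ Y at x
  have hx' : (projectiveResolution X).complex.d (n+2) (n+1) ≫ x = 0 := hx
  have := (projectiveResolution X).complex_exactAt_succ n
  rw [HomologicalComplex.exactAt_iff' _ (n+2) (n+1) n (by simp) (by simp)] at this
  exact ⟨this.descToInjective x hx', this.comp_descToInjective x hx'⟩

end Hom0
end LCaux
end

noncomputable section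
open CategoryTheory CategoryTheory.Limits Opposite


namespace LCaux

section LCsec
variable {R : Type u} [CommRing R] (a : Ideal R)

abbrev Rq (t : ℕ) : ModuleCat.{u} R := ModuleCat.of R (R ⧸ a ^ t)

abbrev dg (n : ℕ) := localCohomology.diagram (localCohomology.idealPowersDiagram a) n

instance : IsFiltered (ℕᵒᵖᵒᵖ) := inferInstance

def leg (n t : ℕ) (Y : ModuleCat.{u} R) : EX n (Rq a t) Y ⟶ (localCohomology a n).obj Y :=
  (colimit.ι (dg a n) (op (op t))).app Y

def qm {t s : ℕ} (h : t ≤ s) : Rq a s ⟶ Rq a t :=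
  (localCohomology.ringModIdeals (localCohomology.idealPowersDiagram a)).map (homOfLE h).op

def tr (n : ℕ) {t s : ℕ} (h : t ≤ s) (Y : ModuleCat.{u} R) : EX n (Rq a t) Y ⟶ EX n (Rq a s) Y :=
  ((Ext R (ModuleCat.{u} R) n).map (qm a h).op).app Y

lemma tr_leg (n : ℕ) {t s : ℕ} (h : t ≤ s) (Y : ModuleCat.{u} R) : tr a n h Y ≫ leg a n s Y = leg a n t Y := by
  have := congrArg (fun z => NatTrans.app z Y) (colimit.w (dg a n) (homOfLE h).op.op)
  exact this

lemma leg_nat (n t : ℕ) {Y Z : ModuleCat.{u} R} (f : Y ⟶ Z) :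
    leg a n t Y ≫ (localCohomology a n).map f = ((Ext R (ModuleCat.{u} R) n).obj (op (Rq a t))).map f ≫ leg a n t Z :=
  ((colimit.ι (dg a n) (op (op t))).naturality f).symm

instance pfc0 : PreservesFilteredColimitsOfSize.{0, 0} (forget (ModuleCat.{u} R)) :=
  preservesSmallestFilteredColimits_of_preservesFilteredColimits _

def ic (n : ℕ) (Y : ModuleCat.{u} R) := 
  isColimitOfPreserves ((evaluation _ (ModuleCat.{u} R)).obj Y) (colimit.isColimit (dg a n))

lemma leg_surj (n : ℕ) {Y : ModuleCat.{u} R} (x : (localCohomology a n).obj Y) :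
    ∃ t e, leg a n t Y e = x := by
  obtain ⟨j, y, hy⟩ := Concrete.isColimit_exists_rep _ (ic a n Y) x
  exact ⟨j.unop.unop, y, hy⟩

lemma leg_zero (n : ℕ) {Y : ModuleCat.{u} R} (t : ℕ) (e : EX n (Rq a t) Y) (h : leg a n t Y e = 0) :
    ∃ s, ∃ h : t ≤ s, tr a n h Y e = 0 := by
  have h2 : leg a n t Y e = leg a n t Y 0 := by rw [h, map_zero]
  obtain ⟨j, f, g, y⟩ := (Concrete.isColimit_rep_eq_iff_exists _ (ic a n Y) (i := op (op t)) (j := op (op t)) e 0).1 h2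
  refine ⟨j.unop.unop, leOfHom f.unop.unop, ?_⟩
  have hh : (dg a n ⋙ (evaluation (ModuleCat R) (ModuleCat R)).obj Y).map g 0 = 0 := map_zero _
  rw [hh] at y
  exact y

def lδ {S : ShortComplex (ModuleCat.{u} R)} (hS : S.ShortExact) (n : ℕ) :
    (localCohomology a n).obj S.X₃ ⟶ (localCohomology a (n+1)).obj S.X₁ :=
  (ic a n S.X₃).desc
    { pt := (localCohomology a (n+1)).obj S.X₁
      ι := 
        { app := fun j => eδ hS n (Rq a j.unop.unop) ≫ leg a (n+1) j.unop.unop S.X₁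
          naturality := fun i j f => by
            have h1 := eδ_nat hS n (qm a (leOfHom f.unop.unop))
            have h2 := tr_leg a (n+1) (leOfHom f.unop.unop) S.X₁
            refine (Category.assoc _ _ _).symm.trans ((congrArg (· ≫ _) h1).trans ?_)
            refine (Category.assoc _ _ _).trans ?_
            exact (congrArg (_ ≫ ·) h2).trans (Category.comp_id _).symm } }

lemma leg_lδ {S : ShortComplex (ModuleCat.{u} R)} (hS : S.ShortExact) (n t : ℕ) :
    leg a n t S.X₃ ≫ lδ a hS n = eδ hS n (Rq a t) ≫ leg a (n+1) t S.X₁ :=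
  (ic a n S.X₃).fac _ (op (op t))

lemma tr_nat (n : ℕ) {t s : ℕ} (h : t ≤ s) {Y Z : ModuleCat.{u} R} (f : Y ⟶ Z) :
    tr a n h Y ≫ ((Ext R (ModuleCat.{u} R) n).obj (op (Rq a s))).map f =
     ((Ext R (ModuleCat.{u} R) n).obj (op (Rq a t))).map f ≫ tr a n h Z :=
  (((Ext R (ModuleCat.{u} R) n).map (qm a h).op).naturality f).symm

lemma tr_δ {S : ShortComplex (ModuleCat.{u} R)} (hS : S.ShortExact) (n : ℕ) {t s : ℕ} (h : t ≤ s) :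
    tr a n h S.X₃ ≫ eδ hS n (Rq a s) = eδ hS n (Rq a t) ≫ tr a (n+1) h S.X₁ :=
  eδ_nat hS n (qm a h)

/-- generic exactness transfer through the colimit -/
lemma exact_transfer {i j k : ℕ} {A B C : ModuleCat.{u} R}
    (f : ∀ t, EX i (Rq a t) A ⟶ EX j (Rq a t) B) (g : ∀ t, EX j (Rq a t) B ⟶ EX k (Rq a t) C)
    (F : (localCohomology a i).obj A ⟶ (localCohomology a j).obj B)
    (G : (localCohomology a j).obj B ⟶ (localCohomology a k).obj C)
    (hF : ∀ t, leg a i t A ≫ F = f t ≫ leg a j t B) (hG : ∀ t, leg a j t B ≫ G = g t ≫ leg a k t C)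
    (hg : ∀ t s (h : t ≤ s), tr a j h B ≫ g s = g t ≫ tr a k h C)
    (hex : ∀ t, Function.Exact (f t) (g t)) : Function.Exact F G := by
  have hF' : ∀ t x, F (leg a i t A x) = leg a j t B (f t x) := fun t x => 
    congrArg (fun z => z.hom x) (hF t)
  have hG' : ∀ t x, G (leg a j t B x) = leg a k t C (g t x) := fun t x => 
    congrArg (fun z => z.hom x) (hG t)
  have hg' : ∀ t s (h : t ≤ s) x, g s (tr a j h B x) = tr a k h C (g t x) := fun t s h x => 
    congrArg (fun z => z.hom x) (hg t s h)
  have tl : ∀ t s (h : t ≤ s) x, leg a j s B (tr a j h B x) = leg a j t B x := fun t s h x => 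
    congrArg (fun z => z.hom x) (tr_leg a j h B)
  intro y
  constructor
  · intro hy
    obtain ⟨t, e, rfl⟩ := leg_surj a j y
    rw [hG'] at hy
    obtain ⟨s, h, hs⟩ := leg_zero a k t _ hy
    rw [← hg'] at hs
    obtain ⟨x, hx⟩ := (hex s _).1 hs
    refine ⟨leg a i s A x, ?_⟩
    rw [hF', hx, tl]
  · rintro ⟨x, rfl⟩
    obtain ⟨t, e, rfl⟩ := leg_surj a i x
    rw [hF', hG', (hex t).apply_apply_eq_zero, map_zero]

lemma lexact₂ {S : ShortComplex (ModuleCat.{u} R)} (hS : S.ShortExact) (n : ℕ) :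
    Function.Exact ((localCohomology a n).map S.f) ((localCohomology a n).map S.g) :=
  exact_transfer a _ _ _ _ (fun t => leg_nat a n t S.f) (fun t => leg_nat a n t S.g)
    (fun _ _ h => tr_nat a n h S.g) (fun t => eexact₂ hS n (Rq a t))

lemma lexact₃ {S : ShortComplex (ModuleCat.{u} R)} (hS : S.ShortExact) (n : ℕ) :
    Function.Exact ((localCohomology a n).map S.g) (lδ a hS n) :=
  exact_transfer a _ _ _ _ (fun t => leg_nat a n t S.g) (fun t => leg_lδ a hS n t)
    (fun _ _ h => tr_δ a hS n h) (fun t => eexact₃ hS n (Rq a t))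

lemma lexact₁ {S : ShortComplex (ModuleCat.{u} R)} (hS : S.ShortExact) (n : ℕ) :
    Function.Exact (lδ a hS n) ((localCohomology a (n+1)).map S.f) :=
  exact_transfer a _ _ _ _ (fun t => leg_lδ a hS n t) (fun t => leg_nat a (n+1) t S.f)
    (fun _ _ h => tr_nat a (n+1) h S.f) (fun t => eexact₁ hS n (Rq a t))

lemma lc_torsion (n : ℕ) {Y : ModuleCat.{u} R} (x : (localCohomology a n).obj Y) :
    ∃ t, ∀ r ∈ a ^ t, r • x = 0 := by
  obtain ⟨t, e, rfl⟩ := leg_surj a n x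
  refine ⟨t, fun r hr => ?_⟩
  rw [← map_smul, ext_killed, map_zero]
  intro x
  obtain ⟨x, rfl⟩ := Ideal.Quotient.mk_surjective x
  exact (Submodule.Quotient.mk_eq_zero _).2 (Ideal.mul_mem_right _ _ hr)

lemma lc_map_smul (n : ℕ) {Y Z : ModuleCat.{u} R} (f : Y ⟶ Z) (r : R) :
    (localCohomology a n).map (r • f) = r • (localCohomology a n).map f := by
  ext x
  obtain ⟨t, e, rfl⟩ := leg_surj a n x
  have h1 := congrArg (fun z => z.hom e) (leg_nat a n t (r • f))
  have h2 := congrArg (fun z => r • z.hom e) (leg_nat a n t f)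
  rw [ext_map_smul] at h1
  refine h1.trans (Eq.trans ?_ h2.symm)
  exact map_smul (leg a n t Z).hom r _

lemma lc_map_add (n : ℕ) {Y Z : ModuleCat.{u} R} (f g : Y ⟶ Z) :
    (localCohomology a n).map (f + g) = (localCohomology a n).map f + (localCohomology a n).map g := by
  ext x
  obtain ⟨t, e, rfl⟩ := leg_surj a n x
  have h1 := congrArg (fun z => z.hom e) (leg_nat a n t (f + g))
  have h2 := congrArg (fun z => z.hom e) (leg_nat a n t f)
  have h3 := congrArg (fun z => z.hom e) (leg_nat a n t g)
  rw [ext_map_add] at h1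
  refine h1.trans (Eq.trans ?_ (congrArg₂ (· + ·) h2 h3).symm)
  exact map_add (leg a n t Z).hom _ _

lemma lc_inj (n : ℕ) (Y : ModuleCat.{u} R) [Injective Y] (x : (localCohomology a (n+1)).obj Y) : x = 0 := by
  obtain ⟨t, e, rfl⟩ := leg_surj a (n+1) x
  have := ModuleCat.subsingleton_of_isZero (ext_injective n (Rq a t) Y)
  rw [Subsingleton.elim e 0, map_zero]

end LCsec
end LCaux
end

noncomputable section
open CategoryTheory CategoryTheory.Limits Opposite


namespace LCaux

section Eps
variable {R : Type u} [CommRing R] (a : Ideal R)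

def ev1 (t : ℕ) (Y : ModuleCat.{u} R) : EX 0 (Rq a t) Y →ₗ[R] Y where
  toFun e := (((e0 (Rq a t) Y).hom e : Rq a t ⟶ Y)).hom (Ideal.Quotient.mk _ 1)
  map_add' e e' := by rw [map_add]; rfl
  map_smul' r e := by rw [map_smul]; rfl

lemma ev1_tr {t s : ℕ} (h : t ≤ s) (Y : ModuleCat.{u} R) (e : EX 0 (Rq a t) Y) :
   ev1 a s Y (tr a 0 h Y e) = ev1 a t Y e := by
  have := e0_nat_left Y (qm a h) e
  exact congrArg (fun z : Rq a s ⟶ Y => z.hom (Ideal.Quotient.mk _ 1)) this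

lemma ev1_nat (t : ℕ) {Y Z : ModuleCat.{u} R} (f : Y ⟶ Z) (e : EX 0 (Rq a t) Y) :
    ev1 a t Z (((Ext R (ModuleCat.{u} R) 0).obj (op (Rq a t))).map f e) = f (ev1 a t Y e) := by
  have := e0_nat (Rq a t) f e
  exact congrArg (fun z : Rq a t ⟶ Z => z.hom (Ideal.Quotient.mk _ 1)) this

lemma ev1_inj (t : ℕ) (Y : ModuleCat.{u} R) : Function.Injective (ev1 a t Y) := by
  rw [injective_iff_map_eq_zero]
  intro e he
  have h2 : ((e0 (Rq a t) Y).hom e : Rq a t ⟶ Y) = 0 := by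
    refine ModuleCat.hom_ext (LinearMap.ext fun x => ?_)
    obtain ⟨x, rfl⟩ := Ideal.Quotient.mk_surjective x
    have hx : (Ideal.Quotient.mk (a^t) x : Rq a t) = x • (Ideal.Quotient.mk (a^t) 1 : Rq a t) := by
      change Ideal.Quotient.mk (a^t) x = Ideal.Quotient.mk (a^t) (x * 1)
      rw [mul_one]
    rw [hx, map_smul]
    exact (congrArg (x • ·) he).trans (smul_zero x)
  have := congrArg (e0 (Rq a t) Y).inv (show (e0 (Rq a t) Y).hom e = 0 from h2)
  rw [map_zero] at this
  have h3 : (e0 (Rq a t) Y).inv ((e0 (Rq a t) Y).hom e) = e := 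
    congrArg (fun z => z.hom e) (e0 (Rq a t) Y).hom_inv_id
  rw [← h3]; exact this

lemma ev1_surj (t : ℕ) (Y : ModuleCat.{u} R) (y : Y) (hy : ∀ r ∈ a ^ t, r • y = 0) : ∃ e, ev1 a t Y e = y := by
  let f : Rq a t ⟶ Y := ModuleCat.ofHom ((a^t).liftQ (LinearMap.toSpanSingleton R Y y) (by
    intro r hr
    exact hy r hr))
  refine ⟨(e0 (Rq a t) Y).inv f, ?_⟩
  have h3 : (e0 (Rq a t) Y).hom ((e0 (Rq a t) Y).inv f) = f := 
    congrArg (fun z => z.hom f) (e0 (Rq a t) Y).inv_hom_id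
  refine (congrArg (fun z : Rq a t ⟶ Y => z.hom (Ideal.Quotient.mk _ 1)) h3).trans ?_
  exact one_smul R y

def eps (Y : ModuleCat.{u} R) : (localCohomology a 0).obj Y ⟶ Y :=
  (ic a 0 Y).desc
    { pt := Y
      ι := 
        { app := fun j => ModuleCat.ofHom (ev1 a j.unop.unop Y)
          naturality := fun i j f => by
            ext e
            exact ev1_tr a (leOfHom f.unop.unop) Y e } }

lemma leg_eps' (t : ℕ) (Y : ModuleCat.{u} R) : leg a 0 t Y ≫ eps a Y = ModuleCat.ofHom (ev1 a t Y) :=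
  (ic a 0 Y).fac _ (op (op t))

lemma leg_eps (t : ℕ) (Y : ModuleCat.{u} R) (e : EX 0 (Rq a t) Y) : eps a Y (leg a 0 t Y e) = ev1 a t Y e :=
  congrArg (fun z => z.hom e) (leg_eps' a t Y)

lemma eps_nat {Y Z : ModuleCat.{u} R} (f : Y ⟶ Z) (x : (localCohomology a 0).obj Y) :
    eps a Z ((localCohomology a 0).map f x) = f (eps a Y x) := by
  obtain ⟨t, e, rfl⟩ := leg_surj a 0 x
  rw [leg_eps, ← ev1_nat, ← leg_eps]
  exact congrArg _ (congrArg (fun z => z.hom e) (leg_nat a 0 t f))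

lemma eps_inj (Y : ModuleCat.{u} R) : Function.Injective (eps a Y) := by
  rw [injective_iff_map_eq_zero]
  intro x hx
  obtain ⟨t, e, rfl⟩ := leg_surj a 0 x
  rw [leg_eps] at hx
  rw [(injective_iff_map_eq_zero _).1 (ev1_inj a t Y) e hx, map_zero]

lemma eps_surj (Y : ModuleCat.{u} R) (t : ℕ) (y : Y) (hy : ∀ r ∈ a ^ t, r • y = 0) : ∃ x, eps a Y x = y := by
  obtain ⟨e, he⟩ := ev1_surj a t Y y hy
  exact ⟨leg a 0 t Y e, by rw [leg_eps, he]⟩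

/-! Unbundled interface -/

abbrev LC (n : ℕ) (M : Type u) [AddCommGroup M] [Module R M] : Type u :=
  (localCohomology a n).obj (ModuleCat.of R M)

variable {M N L : Type u} [AddCommGroup M] [Module R M] [AddCommGroup N] [Module R N]
  [AddCommGroup L] [Module R L]

def lmap (n : ℕ) (f : M →ₗ[R] N) : LC a n M →ₗ[R] LC a n N := 
  ((localCohomology a n).map (ModuleCat.ofHom f)).hom

lemma lmap_comp (n : ℕ) (g : N →ₗ[R] L) (f : M →ₗ[R] N) : lmap a n (g ∘ₗ f) = lmap a n g ∘ₗ lmap a n f := by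
  have := (localCohomology a n).map_comp (ModuleCat.ofHom f) (ModuleCat.ofHom g)
  exact congrArg ModuleCat.Hom.hom this

lemma lmap_id (n : ℕ) : lmap a n (LinearMap.id : M →ₗ[R] M) = LinearMap.id := by
  have := (localCohomology a n).map_id (ModuleCat.of R M)
  exact congrArg ModuleCat.Hom.hom this

lemma lmap_add (n : ℕ) (f g : M →ₗ[R] N) : lmap a n (f + g) = lmap a n f + lmap a n g := 
  congrArg ModuleCat.Hom.hom (lc_map_add a n (ModuleCat.ofHom f) (ModuleCat.ofHom g))

lemma lmap_smul (n : ℕ) (r : R) (f : M →ₗ[R] N) : lmap a n (r • f) = r • lmap a n f := 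
  congrArg ModuleCat.Hom.hom (lc_map_smul a n (ModuleCat.ofHom f) r)

lemma les (n : ℕ) (f : M →ₗ[R] N) (g : N →ₗ[R] L) (hf : Function.Injective f) (hg : Function.Surjective g)
    (h : Function.Exact f g) : ∃ δ : LC a n L →ₗ[R] LC a (n+1) M, 
      Function.Exact (lmap a n g) δ ∧ Function.Exact δ (lmap a (n+1) f) := by
  let S : ShortComplex (ModuleCat.{u} R) := ShortComplex.mk (ModuleCat.ofHom f) (ModuleCat.ofHom g) (by
    ext x; exact h.apply_apply_eq_zero x)
  have hS : S.ShortExact := ShortComplex.ShortExact.mk'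
    ((ShortComplex.ShortExact.moduleCat_exact_iff_function_exact _).2 h)
    ((ModuleCat.mono_iff_injective _).2 hf) ((ModuleCat.epi_iff_surjective _).2 hg)
  exact ⟨(lδ a hS n).hom, lexact₃ a hS n, lexact₁ a hS n⟩

lemma lmid (n : ℕ) (f : M →ₗ[R] N) (g : N →ₗ[R] L) (hf : Function.Injective f) (hg : Function.Surjective g)
    (h : Function.Exact f g) : Function.Exact (lmap a n f) (lmap a n g) := by
  let S : ShortComplex (ModuleCat.{u} R) := ShortComplex.mk (ModuleCat.ofHom f) (ModuleCat.ofHom g) (by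
    ext x; exact h.apply_apply_eq_zero x)
  have hS : S.ShortExact := ShortComplex.ShortExact.mk'
    ((ShortComplex.ShortExact.moduleCat_exact_iff_function_exact _).2 h)
    ((ModuleCat.mono_iff_injective _).2 hf) ((ModuleCat.epi_iff_surjective _).2 hg)
  exact lexact₂ a hS n

lemma ltors (n : ℕ) (x : LC a n M) : ∃ t, ∀ r ∈ a ^ t, r • x = 0 := lc_torsion a n x

def leps (M : Type u) [AddCommGroup M] [Module R M] : LC a 0 M →ₗ[R] M := (eps a (ModuleCat.of R M)).hom

lemma leps_inj : Function.Injective (leps a M) := eps_inj a _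

lemma leps_surj (y : M) (t : ℕ) (hy : ∀ r ∈ a ^ t, r • y = 0) : ∃ x, leps a M x = y :=
  eps_surj a (ModuleCat.of R M) t y hy

lemma leps_nat (f : M →ₗ[R] N) (x : LC a 0 M) : leps a N (lmap a 0 f x) = f (leps a M x) := 
  eps_nat a (ModuleCat.ofHom f) x

lemma linj (n : ℕ) (h : Module.Injective R M) (x : LC a (n+1) M) : x = 0 := by
  have : Injective (ModuleCat.of R M) := Module.injective_object_of_injective_module R M
  exact lc_inj a n _ x

lemma exists_inj_embed (M : Type u) [AddCommGroup M] [Module R M] :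
    ∃ (E : Type u) (_ : AddCommGroup E) (_ : Module R E) (f : M →ₗ[R] E), Module.Injective R E ∧ Function.Injective f := by
  let I := Injective.under (ModuleCat.of R M)
  have : Injective (ModuleCat.of R I) := inferInstanceAs (Injective I)
  refine ⟨I, inferInstance, inferInstance, (Injective.ι (ModuleCat.of R M)).hom, Module.injective_module_of_injective_object R I, ?_⟩
  exact (ModuleCat.mono_iff_injective _).1 inferInstance

end Eps
end LCaux
end

noncomputable section
namespace LCaux

section Tors
variable {R : Type u} [CommRing R] (a : Ideal R)

def Gam (M : Type u) [AddCommGroup M] [Module R M] : Submodule R M where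
  carrier := {x | ∃ t, ∀ r ∈ a ^ t, r • x = 0}
  zero_mem' := ⟨0, fun r _ => smul_zero r⟩
  add_mem' := by
    rintro x y ⟨t, ht⟩ ⟨s, hs⟩
    refine ⟨t + s, fun r hr => ?_⟩
    rw [smul_add, ht r (Ideal.pow_le_pow_right (by omega) hr), hs r (Ideal.pow_le_pow_right (by omega) hr), add_zero]
  smul_mem' := by
    rintro c x ⟨t, ht⟩
    exact ⟨t, fun r hr => by rw [smul_comm, ht r hr, smul_zero]⟩

variable {M N L : Type u} [AddCommGroup M] [Module R M] [AddCommGroup N] [Module R N]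

lemma mem_Gam {x : M} : x ∈ Gam a M ↔ ∃ t, ∀ r ∈ a ^ t, r • x = 0 := Iff.rfl

/-- a f.g. torsion module is killed by a single power -/
lemma fg_tors (K : Submodule R M) (hK : K.FG) (h : K ≤ Gam a M) : ∃ t, ∀ r ∈ a ^ t, ∀ x ∈ K, r • x = 0 := by
  induction K, hK using Submodule.fg_induction with
  | singleton x => 
    obtain ⟨t, ht⟩ := h (Submodule.mem_span_singleton_self x)
    refine ⟨t, fun r hr y hy => ?_⟩
    obtain ⟨c, rfl⟩ := Submodule.mem_span_singleton.1 hy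
    rw [smul_comm, ht r hr, smul_zero]
  | sup K₁ K₂ _ _ h₁ h₂ =>
    obtain ⟨t, ht⟩ := h₁ (le_sup_left.trans h)
    obtain ⟨s, hs⟩ := h₂ (le_sup_right.trans h)
    refine ⟨t + s, fun r hr y hy => ?_⟩
    obtain ⟨y, hy', z, hz, rfl⟩ := Submodule.mem_sup.1 hy
    rw [smul_add, ht r (Ideal.pow_le_pow_right (by omega) hr) y hy', hs r (Ideal.pow_le_pow_right (by omega) hr) z hz, add_zero]

lemma inj_ext {E : Type u} [AddCommGroup E] [Module R E] (hE : Module.Injective R E) (f : M →ₗ[R] N) (g : M →ₗ[R] E)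
    (h : LinearMap.ker f ≤ LinearMap.ker g) : ∃ k : N →ₗ[R] E, ∀ x, k (f x) = g x := by
  obtain ⟨k, hk⟩ := hE.out ((LinearMap.ker f).liftQ f le_rfl) (by
    rw [← LinearMap.ker_eq_bot]; exact Submodule.ker_liftQ_eq_bot _ _ _ le_rfl) ((LinearMap.ker f).liftQ g h)
  exact ⟨k, fun x => hk (Submodule.Quotient.mk x)⟩

variable [IsNoetherianRing R]

lemma Gam_injective {E : Type u} [AddCommGroup E] [Module R E] (hE : Module.Injective R E) :
    Module.Injective R (Gam a E) := by
  apply Module.Baer.injective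
  intro I g
  obtain ⟨k, hk⟩ := fg_tors a (LinearMap.range ((Gam a E).subtype ∘ₗ g)) 
    (by rw [LinearMap.range_eq_map]; exact (IsNoetherian.noetherian _).map _) (by rintro _ ⟨x, rfl⟩; exact (g x).2)
  obtain ⟨s, hs⟩ : ∃ s, a ^ s ⊓ I ≤ a ^ k * I := by
    obtain ⟨k0, h0⟩ := Ideal.exists_pow_inf_eq_pow_smul a (I : Submodule R R)
    refine ⟨k + k0, ?_⟩
    have := h0 (k + k0) (by omega)
    simp only [smul_eq_mul, Ideal.mul_top, Nat.add_sub_cancel] at this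
    rw [this]
    exact Ideal.mul_mono_right inf_le_right
  obtain ⟨h, hh⟩ := inj_ext hE ((a^s).mkQ ∘ₗ I.subtype) ((Gam a E).subtype ∘ₗ g) (by
    intro x hx
    have hx' : (x : R) ∈ a ^ s := Ideal.Quotient.eq_zero_iff_mem.1 (by simpa using hx)
    have h2 : (x : R) ∈ a ^ k * I := hs ⟨hx', x.2⟩
    have key : ∀ y ∈ a ^ k * I, ∃ hy : y ∈ I, ((g ⟨y, hy⟩ : Gam a E) : E) = 0 := by
      intro y hy
      refine Submodule.mul_induction_on hy ?_ ?_
      · intro m hm n hn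
        refine ⟨I.mul_mem_left m hn, ?_⟩
        have : (⟨m * n, I.mul_mem_left m hn⟩ : I) = m • ⟨n, hn⟩ := rfl
        rw [this, map_smul]
        exact hk m hm _ ⟨⟨n, hn⟩, rfl⟩
      · rintro x y ⟨hxI, hx⟩ ⟨hyI, hy⟩
        refine ⟨I.add_mem hxI hyI, ?_⟩
        have : (⟨x + y, I.add_mem hxI hyI⟩ : I) = ⟨x, hxI⟩ + ⟨y, hyI⟩ := rfl
        rw [this, map_add, Submodule.coe_add, hx, hy, add_zero]
    exact (key x h2).2)
  refine ⟨LinearMap.codRestrict (Gam a E) (h ∘ₗ (a^s).mkQ) ?_, ?_⟩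
  · intro x
    refine ⟨s, fun r hr => ?_⟩
    rw [← map_smul]
    have : (a^s).mkQ (r • x) = 0 := by
      exact Ideal.Quotient.eq_zero_iff_mem.2 (Ideal.mul_mem_right x _ hr)
    rw [LinearMap.comp_apply, this, map_zero]
  · intro x mem
    ext
    exact hh ⟨x, mem⟩

lemma ltors_zero (n : ℕ) : ∀ (M : Type u) [AddCommGroup M] [Module R M] (hM : Gam a M = ⊤) (x : LC a (n+1) M), x = 0 := by
  induction n with
  | zero => 
    intro M _ _ hM x
    obtain ⟨E, _, _, f, hE, hf⟩ := exists_inj_embed (R := R) M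
    let f' : M →ₗ[R] Gam a E := f.codRestrict _ (fun y => by
      obtain ⟨t, ht⟩ := (hM.ge (Submodule.mem_top : y ∈ ⊤))
      exact ⟨t, fun r hr => by rw [← map_smul, ht r hr, map_zero]⟩)
    have hf' : Function.Injective f' := fun y z hyz => hf (congrArg Subtype.val hyz)
    obtain ⟨δ, h1, h2⟩ := les a 0 f' (LinearMap.range f').mkQ hf' (Submodule.mkQ_surjective _)
      (LinearMap.exact_map_mkQ_range f')
    obtain ⟨y, rfl⟩ := (h2 x).1 (linj a 0 (Gam_injective a hE) _)
    obtain ⟨w, hw⟩ := Submodule.mkQ_surjective _ (leps a _ y)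
    obtain ⟨t, ht⟩ := w.2
    obtain ⟨v, hv⟩ := leps_surj a w t (fun r hr => Subtype.ext (ht r hr))
    apply (h1 y).2
    refine ⟨v, ?_⟩
    apply leps_inj
    rw [leps_nat, hv, hw]
  | succ n ih =>
    intro M _ _ hM x
    obtain ⟨E, _, _, f, hE, hf⟩ := exists_inj_embed (R := R) M
    let f' : M →ₗ[R] Gam a E := f.codRestrict _ (fun y => by
      obtain ⟨t, ht⟩ := (hM.ge (Submodule.mem_top : y ∈ ⊤))
      exact ⟨t, fun r hr => by rw [← map_smul, ht r hr, map_zero]⟩)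
    have hf' : Function.Injective f' := fun y z hyz => hf (congrArg Subtype.val hyz)
    obtain ⟨δ, h1, h2⟩ := les a (n+1) f' (LinearMap.range f').mkQ hf' (Submodule.mkQ_surjective _)
      (LinearMap.exact_map_mkQ_range f')
    obtain ⟨y, rfl⟩ := (h2 x).1 (linj a _ (Gam_injective a hE) _)
    rw [ih _ _ y, map_zero]
    rw [eq_top_iff]
    rintro z -
    obtain ⟨w, rfl⟩ := Submodule.mkQ_surjective _ z
    obtain ⟨t, ht⟩ := w.2
    exact ⟨t, fun r hr => by rw [← map_smul, show r • w = 0 from Subtype.ext (ht r hr), map_zero]⟩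

end Tors
end LCaux
end

noncomputable section
open scoped Pointwise
namespace LCaux

section P8
variable {R : Type u} [CommRing R] (a : Ideal R)
variable {M N L : Type u} [AddCommGroup M] [Module R M] [AddCommGroup N] [Module R N] [AddCommGroup L] [Module R L]

lemma lc_top (ha : a = ⊤) (n : ℕ) : Subsingleton (LC a n M) := by
  refine subsingleton_of_forall_eq 0 fun x => ?_
  obtain ⟨t, ht⟩ := ltors a n x
  subst ha
  have := ht 1 (by rw [Ideal.top_pow]; trivial)
  rwa [one_smul] at this

lemma lmap_surj_zero (n : ℕ) (f : M →ₗ[R] N) (g : N →ₗ[R] L) (hf : Function.Injective f) (hg : Function.Surjective g)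
    (h : Function.Exact f g) [Subsingleton (LC a (n+1) M)] : Function.Surjective (lmap a n g) := by
  obtain ⟨δ, h1, -⟩ := les a n f g hf hg h
  intro x
  exact (h1 x).1 (Subsingleton.elim _ _)

lemma lmap_inj_zero (n : ℕ) (f : M →ₗ[R] N) (g : N →ₗ[R] L) (hf : Function.Injective f) (hg : Function.Surjective g)
    (h : Function.Exact f g) [Subsingleton (LC a n M)] : Function.Injective (lmap a n g) := by
  rw [injective_iff_map_eq_zero]
  intro x hx
  obtain ⟨y, rfl⟩ := (lmid a n f g hf hg h x).1 hx
  rw [Subsingleton.elim y 0, map_zero]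

lemma lc_equiv_sub (n : ℕ) (e : M ≃ₗ[R] N) [Subsingleton (LC a n M)] : Subsingleton (LC a n N) := by
  refine subsingleton_of_forall_eq 0 fun x => ?_
  have : lmap a n (e.toLinearMap ∘ₗ e.symm.toLinearMap) x = x := by
    rw [show e.toLinearMap ∘ₗ e.symm.toLinearMap = LinearMap.id by ext; simp, lmap_id]; rfl
  rw [← this, lmap_comp]
  simp [Subsingleton.elim (lmap a n e.symm.toLinearMap x) 0]

lemma lc_zero_mod (n : ℕ) [Subsingleton M] : Subsingleton (LC a n M) := by
  refine subsingleton_of_forall_eq 0 fun x => ?_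
  have : lmap a n ((0:R) • (LinearMap.id : M →ₗ[R] M)) x = x := by
    rw [show ((0:R) • (LinearMap.id : M →ₗ[R] M)) = LinearMap.id by ext; exact Subsingleton.elim _ _, lmap_id]; rfl
  rw [← this, lmap_smul]; simp

lemma exact_sub (K : Submodule R M) : Function.Exact K.subtype K.mkQ := LinearMap.exact_subtype_mkQ K

/-- elements killing `M` kill `LC`. -/
lemma lc_ann (n : ℕ) (r : R) (hr : r ∈ Module.annihilator R M) (x : LC a n M) : r • x = 0 := by
  have : lmap a n (r • (LinearMap.id : M →ₗ[R] M)) x = r • x := by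
    rw [lmap_smul, lmap_id]; rfl
  rw [← this, show (r • (LinearMap.id : M →ₗ[R] M)) = (0:R) • LinearMap.id by 
    ext y; simpa using Module.mem_annihilator.1 hr y, lmap_smul]; simp

lemma gam_gam [IsNoetherianRing R] [Module.Finite R M] : Gam a (M ⧸ Gam a M) = ⊥ := by
  rw [eq_bot_iff]
  intro x hx
  obtain ⟨x, rfl⟩ := Submodule.Quotient.mk_surjective _ x
  obtain ⟨t, ht⟩ := hx
  obtain ⟨s, hs⟩ := fg_tors a (Gam a M) (IsNoetherian.noetherian _) le_rfl
  rw [Submodule.mem_bot, Submodule.Quotient.mk_eq_zero]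
  refine ⟨s + t, fun r hr => ?_⟩
  rw [pow_add] at hr
  refine Submodule.mul_induction_on hr (fun p hp q hq => ?_) (fun p q hp hq => by rw [add_smul, hp, hq, add_zero])
  rw [mul_smul]
  refine hs p hp _ ?_
  rw [← Submodule.Quotient.mk_eq_zero, Submodule.Quotient.mk_smul, ht q hq]

lemma gam_sub_top : Gam a (Gam a M) = ⊤ := by
  rw [eq_top_iff]
  rintro ⟨x, t, ht⟩ -
  exact ⟨t, fun r hr => Subtype.ext (ht r hr)⟩

lemma ltors_sub [IsNoetherianRing R] (n : ℕ) (hM : Gam a M = ⊤) : Subsingleton (LC a (n+1) M) :=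
  subsingleton_of_forall_eq 0 (ltors_zero a n M hM)

lemma gam_inj [IsNoetherianRing R] (n : ℕ) : Function.Injective (lmap a (n+1) (Gam a M).mkQ) := by
  have := ltors_sub a n (gam_sub_top a (M := M))
  exact lmap_inj_zero a (n+1) _ _ (Submodule.injective_subtype _) (Submodule.mkQ_surjective _) (exact_sub _)

lemma gam_surj [IsNoetherianRing R] (n : ℕ) : Function.Surjective (lmap a n (Gam a M).mkQ) := by
  have := ltors_sub a n (gam_sub_top a (M := M))
  exact lmap_surj_zero a n _ _ (Submodule.injective_subtype _) (Submodule.mkQ_surjective _) (exact_sub _)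

def gamEquiv [IsNoetherianRing R] (n : ℕ) : LC a (n+1) M ≃ₗ[R] LC a (n+1) (M ⧸ Gam a M) :=
  LinearEquiv.ofBijective _ ⟨gam_inj a n, gam_surj a (n+1)⟩

lemma prime_avoid [IsNoetherianRing R] [Module.Finite R M] (h : Gam a M = ⊥) : ∃ y ∈ a, IsSMulRegular M y := by
  by_contra! H
  have h1 : (a : Set R) ⊆ ⋃ p ∈ associatedPrimes R M, (p : Set R) := by
    intro y hy
    rw [biUnion_associatedPrimes_eq_compl_regular R M]
    exact H y hy
  obtain ⟨p, hp, hap⟩ := (Ideal.subset_union_prime_finite (associatedPrimes.finite R M) ⊥ ⊥ (fun q hq _ _ => IsAssociatedPrime.isPrime hq)).1 h1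
  obtain ⟨hp1, x, hx⟩ := id hp
  obtain ⟨t, ht⟩ := Ideal.exists_pow_le_of_le_radical_of_fg (hx ▸ hap) (IsNoetherian.noetherian _)
  have hx0 : x ∈ Gam a M := ⟨t, fun r hr => by simpa using Submodule.mem_colon_singleton.1 (ht hr)⟩
  rw [h, Submodule.mem_bot] at hx0
  subst hx0
  apply hp1.ne_top
  rw [hx, Ideal.eq_top_iff_one]
  exact Ideal.le_radical (Submodule.mem_colon_singleton.2 (by simp))

lemma reg_exact (y : R) (hy : IsSMulRegular M y) : 
    Function.Exact (LinearMap.lsmul R M y) (y • (⊤ : Submodule R M)).mkQ := by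
  intro x
  rw [← LinearMap.mem_ker, Submodule.ker_mkQ, Submodule.mem_smul_pointwise_iff_exists]
  simp

lemma reg_les (i : ℕ) (y : R) (hy : IsSMulRegular M y) :
    ∃ δ : LC a i (QuotSMulTop y M) →ₗ[R] LC a (i+1) M, 
     Function.Exact (lmap a i (y • (⊤ : Submodule R M)).mkQ) δ ∧ Function.Exact δ (LinearMap.lsmul R (LC a (i+1) M) y) := by
  obtain ⟨δ, h1, h2⟩ := les a i (LinearMap.lsmul R M y) (y • (⊤ : Submodule R M)).mkQ hy (Submodule.mkQ_surjective _) (reg_exact y hy)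
  refine ⟨δ, h1, ?_⟩
  have : LinearMap.lsmul R M y = y • LinearMap.id := rfl
  rw [this, lmap_smul, lmap_id] at h2
  exact h2

lemma reg_mid (i : ℕ) (y : R) (hy : IsSMulRegular M y) :
     Function.Exact (LinearMap.lsmul R (LC a i M) y) (lmap a i (y • (⊤ : Submodule R M)).mkQ) := by
  have h2 := lmid a i (LinearMap.lsmul R M y) (y • (⊤ : Submodule R M)).mkQ hy (Submodule.mkQ_surjective _) (reg_exact y hy)
  have : LinearMap.lsmul R M y = y • LinearMap.id := rfl
  rw [this, lmap_smul, lmap_id] at h2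
  exact h2
end P8
end LCaux
end

noncomputable section
open scoped Pointwise
namespace LCaux

section P9

lemma wb_lt (x : WithBot ℕ∞) (i : ℕ) (h : x + 1 < ((i + 1 : ℕ) : WithBot ℕ∞)) : x < (i : WithBot ℕ∞) := by
  induction x with
  | bot => exact WithBot.bot_lt_coe _
  | coe x =>
    induction x with
    | top => exact absurd h (by have e : ((⊤ : ℕ∞) : WithBot ℕ∞) + 1 = ⊤ := rfl
                                try rw [e]
                                simp)
    | coe x => 
      norm_cast at h ⊢
      omega

lemma wb_le (x : WithBot ℕ∞) (i : ℕ) (h : x + 1 ≤ ((i + 1 : ℕ) : WithBot ℕ∞)) : x ≤ (i : WithBot ℕ∞) := by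
  induction x with
  | bot => exact bot_le
  | coe x =>
    induction x with
    | top => 
      have e : ((i + 1 : ℕ) : WithBot ℕ∞) < ((⊤ : ℕ∞) : WithBot ℕ∞) := WithBot.coe_lt_coe.2 (ENat.coe_lt_top (i+1))
      exact absurd h (not_le.2 e)
    | coe x => 
      norm_cast at h ⊢
      omega

lemma wb_le_of_lt (x : WithBot ℕ∞) (i : ℕ) (h : x < ((i + 1 : ℕ) : WithBot ℕ∞)) : x ≤ (i : WithBot ℕ∞) := by
  induction x with
  | bot => exact bot_le
  | coe x =>
    induction x with
    | top => exact absurd h (by have e : ((⊤ : ℕ∞) : WithBot ℕ∞) + 1 = ⊤ := rfl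
                                try rw [e]
                                simp)
    | coe x => 
      norm_cast at h ⊢
      omega

lemma wb_lt_of_le (x : WithBot ℕ∞) (i : ℕ) (h : x ≤ (i : WithBot ℕ∞)) : x < ((i + 1 : ℕ) : WithBot ℕ∞) :=
  lt_of_le_of_lt h (by
    have : ((i : ℕ) : ℕ∞) < ((i+1 : ℕ) : ℕ∞) := by rw [Nat.cast_lt]; omega
    exact WithBot.coe_lt_coe.2 this)

lemma wb_eq (x : WithBot ℕ∞) (i : ℕ) (h : x + 1 = ((i + 1 : ℕ) : WithBot ℕ∞)) : x = (i : WithBot ℕ∞) := by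
  refine le_antisymm (wb_le x i h.le) (not_lt.1 fun h' => ?_)
  rcases i with _ | i
  · have : x = ⊥ := by
      by_contra hb
      obtain ⟨x, rfl⟩ := WithBot.ne_bot_iff_exists.1 hb
      have h0 : (x : WithBot ℕ∞) < ((0 : ℕ∞) : WithBot ℕ∞) := h'
      rw [WithBot.coe_lt_coe] at h0
      exact not_lt_bot h0
    subst this
    exact absurd h (by simpa using WithBot.bot_ne_coe)
  · have h1 := wb_le_of_lt x i h'
    have h2 : x + 1 ≤ ((i + 1 : ℕ) : WithBot ℕ∞) := by 
      push_cast; exact add_le_add h1 le_rfl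
    rw [h] at h2
    exact absurd h2 (not_le.2 (wb_lt_of_le _ (i+1) le_rfl))

variable {R : Type u} [CommRing R] (a : Ideal R)
variable {M N L : Type u} [AddCommGroup M] [Module R M] [AddCommGroup N] [Module R N] [AddCommGroup L] [Module R L]

lemma tors_inj (i : ℕ) (y : R) (hy : y ∈ a) (h : ∀ x : LC a i M, y • x = 0 → x = 0) : Subsingleton (LC a i M) := by
  refine subsingleton_of_forall_eq 0 fun x => ?_
  obtain ⟨t, ht⟩ := ltors a i x
  have h1 := ht (y ^ t) (Ideal.pow_mem_pow hy t)
  clear ht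
  induction t with
  | zero => simpa using h1
  | succ t ih => 
    rw [pow_succ', mul_smul] at h1
    exact ih (h _ h1)

variable [IsNoetherianRing R] [IsLocalRing R]

lemma van (i : ℕ) : ∀ (M : Type u) [AddCommGroup M] [Module R M] [Module.Finite R M], 
    Module.supportDim R M < i → Subsingleton (LC a i M) := by
  induction i with
  | zero => 
    intro M _ _ _ h
    have : Module.supportDim R M = ⊥ := by
      by_contra hb
      obtain ⟨x, hx⟩ := WithBot.ne_bot_iff_exists.1 hb
      rw [← hx] at h
      have h0 : (x : WithBot ℕ∞) < ((0 : ℕ∞) : WithBot ℕ∞) := h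
      rw [WithBot.coe_lt_coe] at h0
      exact not_lt_bot h0
    have := (Module.supportDim_eq_bot_iff_subsingleton R M).1 this
    exact lc_zero_mod a 0
  | succ i ih =>
    intro M _ _ _ h
    by_cases ha : a = ⊤
    · exact lc_top a ha _
    have ham := IsLocalRing.le_maximalIdeal ha
    refine (gamEquiv a i (M := M)).toEquiv.subsingleton_congr.2 ?_
    obtain ⟨y, hy, hreg⟩ := prime_avoid a (gam_gam a (M := M))
    have hd := Module.supportDim_quotSMulTop_succ_eq_supportDim hreg (ham hy)
    have hd2 := Module.supportDim_le_of_surjective (Gam a M).mkQ (Submodule.mkQ_surjective _)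
    have := ih (QuotSMulTop y (M ⧸ Gam a M)) (wb_lt _ _ (by rw [hd]; exact hd2.trans_lt h))
    refine tors_inj a _ y hy fun x hx => ?_
    obtain ⟨δ, -, h2⟩ := reg_les a i y hreg
    obtain ⟨z, rfl⟩ := (h2 x).1 hx
    rw [Subsingleton.elim z 0, map_zero]

lemma rex (n : ℕ) [Module.Finite R M] (hM : Module.supportDim R M ≤ n) (g : M →ₗ[R] N) (hg : Function.Surjective g) :
    Function.Surjective (lmap a n g) := by
  have := van a (n+1) (LinearMap.ker g) (wb_lt_of_le _ _ ((Module.supportDim_le_of_injective _ (Submodule.injective_subtype _)).trans hM))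
  exact lmap_surj_zero a n (LinearMap.ker g).subtype g (Submodule.injective_subtype _) hg (LinearMap.exact_subtype_ker_map g)

end P9
end LCaux
end

noncomputable section
open scoped Pointwise
namespace LCaux

section P10
variable {R : Type u} [CommRing R] (a : Ideal R)
variable {M N L : Type u} [AddCommGroup M] [Module R M] [AddCommGroup N] [Module R N] [AddCommGroup L] [Module R L]

def lmapHom (n : ℕ) : (M →ₗ[R] N) →+ (LC a n M →ₗ[R] LC a n N) :=
  AddMonoidHom.mk' (lmap a n) (lmap_add a n)

lemma lmap_sum {ι : Type*} (s : Finset ι) (n : ℕ) (f : ι → (M →ₗ[R] N)) (x : LC a n M) : 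
    lmap a n (∑ j ∈ s, f j) x = ∑ j ∈ s, lmap a n (f j) x := by
  have := map_sum (lmapHom a n (M := M) (N := N)) f s
  change lmap a n _ = ∑ j ∈ s, lmap a n (f j) at this
  rw [this, LinearMap.sum_apply]

lemma sdim_ann [Module.Finite R M] [Module.Finite R N] (h : Module.annihilator R M ≤ Module.annihilator R N) :
    Module.supportDim R N ≤ Module.supportDim R M := by
  rw [Module.supportDim_eq_ringKrullDim_quotient_annihilator, Module.supportDim_eq_ringKrullDim_quotient_annihilator]
  exact ringKrullDim_le_of_surjective (Ideal.Quotient.factor h) (Ideal.Quotient.factor_surjective h)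

variable [IsNoetherianRing R] [IsLocalRing R]

lemma sum_surj (n k : ℕ) [Module.Finite R M] (hM : Module.supportDim R M ≤ n) (f : Fin k → (M →ₗ[R] N))
    (hs : ∀ x, ∃ v : Fin k → M, ∑ j, f j (v j) = x) (u : LC a n N) :
    ∃ v : Fin k → LC a n M, u = ∑ j, lmap a n (f j) (v j) := by
  let φ : (Fin k → M) →ₗ[R] N := ∑ j, f j ∘ₗ LinearMap.proj j
  have hφ : Function.Surjective φ := fun x => by
    obtain ⟨v, rfl⟩ := hs x
    exact ⟨v, by simp [φ]⟩
  have hd : Module.supportDim R (Fin k → M) ≤ n := by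
    refine (sdim_ann (M := M) fun r hr => ?_).trans hM
    rw [Module.mem_annihilator] at hr ⊢
    intro v; ext j; exact hr (v j)
  obtain ⟨w, rfl⟩ := rex a n hd φ hφ u
  refine ⟨fun j => lmap a n (LinearMap.proj j) w, ?_⟩
  rw [lmap_sum]
  refine Finset.sum_congr rfl fun j _ => ?_
  rw [lmap_comp]; rfl

lemma ideal_ker (n : ℕ) [Module.Finite R M] (hM : Module.supportDim R M ≤ n) (I : Ideal R) :
    LinearMap.ker (lmap a n (I • (⊤ : Submodule R M)).mkQ) = I • (⊤ : Submodule R (LC a n M)) := by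
  apply le_antisymm
  · intro u hu
    rw [LinearMap.mem_ker] at hu
    obtain ⟨w, rfl⟩ := (lmid a n _ _ (Submodule.injective_subtype _) (Submodule.mkQ_surjective _) (exact_sub (I • (⊤ : Submodule R M))) u).1 hu
    obtain ⟨k, r, hr⟩ := Submodule.fg_iff_exists_fin_generating_family.1 (IsNoetherian.noetherian I)
    have hrI : ∀ j, r j ∈ I := fun j => hr ▸ Submodule.subset_span ⟨j, rfl⟩
    let f : Fin k → (M →ₗ[R] (I • (⊤ : Submodule R M) : Submodule R M)) := fun j => 
      LinearMap.codRestrict _ (LinearMap.lsmul R M (r j)) (fun c => Submodule.smul_mem_smul (hrI j) trivial)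
    obtain ⟨v, rfl⟩ := sum_surj a n k hM f (by
      rintro ⟨x, hx⟩
      suffices ∃ v : Fin k → M, ∑ j, r j • v j = x by
        obtain ⟨v, hv⟩ := this
        refine ⟨v, Subtype.ext ?_⟩
        rw [Submodule.coe_sum]
        exact hv
      refine Submodule.smul_induction_on hx ?_ ?_
      · intro c hc m _
        rw [← hr, Submodule.mem_span_range_iff_exists_fun] at hc
        obtain ⟨c, rfl⟩ := hc
        refine ⟨fun j => c j • m, ?_⟩
        rw [Finset.sum_smul]
        refine Finset.sum_congr rfl fun j _ => ?_
        rw [smul_eq_mul, mul_comm, mul_smul]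
      · rintro _ _ ⟨v, rfl⟩ ⟨w, rfl⟩
        exact ⟨v + w, by simp [smul_add, Finset.sum_add_distrib]⟩) w
    rw [map_sum]
    refine Submodule.sum_mem _ fun j _ => ?_
    rw [← LinearMap.comp_apply, ← lmap_comp, show (Submodule.subtype _ ∘ₗ f j) = r j • LinearMap.id from rfl, lmap_smul, lmap_id]
    exact Submodule.smul_mem_smul (hrI j) trivial
  · rw [Submodule.smul_le]
    intro r hr x _
    rw [LinearMap.mem_ker, map_smul]
    apply lc_ann
    rw [Module.mem_annihilator]
    intro m
    obtain ⟨m, rfl⟩ := Submodule.Quotient.mk_surjective _ m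
    rw [← Submodule.Quotient.mk_smul, Submodule.Quotient.mk_eq_zero]
    exact Submodule.smul_mem_smul hr trivial

lemma ideal_smul_top (n : ℕ) [Module.Finite R M] (hM : Module.supportDim R M ≤ n) (I : Ideal R)
    (h : Subsingleton (LC a n (M ⧸ I • (⊤ : Submodule R M)))) : I • (⊤ : Submodule R (LC a n M)) = ⊤ := by
  rw [← ideal_ker a n hM, eq_top_iff]
  intro x _
  exact Subsingleton.elim _ _

lemma elt_smul_top (n : ℕ) [Module.Finite R M] (hM : Module.supportDim R M ≤ n) (x : R)
    (h : Subsingleton (LC a n (QuotSMulTop x M))) (u : LC a n M) : ∃ v, x • v = u := by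
  have h1 : (Ideal.span {x} • (⊤ : Submodule R (LC a n M))) = ⊤ := 
    ideal_smul_top a n hM _ (by rw [Submodule.ideal_span_singleton_smul]; exact h)
  rw [Submodule.ideal_span_singleton_smul] at h1
  have : u ∈ x • (⊤ : Submodule R (LC a n M)) := by rw [h1]; trivial
  rw [Submodule.mem_smul_pointwise_iff_exists] at this
  obtain ⟨v, -, hv⟩ := this
  exact ⟨v, hv⟩

/-- if `p` kills `X`, `dim R/p ≤ n`, `LC n (R/p) = 0` then `LC n X = 0`. -/
lemma lc_of_quot (n : ℕ) [Module.Finite R M] (p : Ideal R) (hp : Module.supportDim R (R ⧸ p) ≤ n) 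
    (h : Subsingleton (LC a n (R ⧸ p))) (hM : p ≤ Module.annihilator R M) : Subsingleton (LC a n M) := by
  obtain ⟨k, g, hg⟩ := Module.Finite.exists_fin (R := R) (M := M)
  refine subsingleton_of_forall_eq 0 fun u => ?_
  obtain ⟨v, rfl⟩ := sum_surj a n k hp (fun j => p.liftQ (LinearMap.toSpanSingleton R M (g j)) (fun r hr => by
     simpa using Module.mem_annihilator.1 (hM hr) (g j))) (by
     intro x
     have : x ∈ Submodule.span R (Set.range g) := by rw [hg]; trivial
     rw [Submodule.mem_span_range_iff_exists_fun] at this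
     obtain ⟨c, rfl⟩ := this
     exact ⟨fun j => Ideal.Quotient.mk p (c j), Finset.sum_congr rfl fun j _ => rfl⟩) u
  refine Finset.sum_eq_zero fun j _ => ?_
  rw [Subsingleton.elim (v j) 0, map_zero]

end P10
end LCaux
end

noncomputable section
open scoped Pointwise
namespace LCaux

section P11
variable {R : Type u} [CommRing R]

lemma melk {N : Type u} [AddCommGroup N] [Module R N] (y : R) (ht : ∀ v : N, ∃ t : ℕ, y ^ t • v = 0)
    (h : IsArtinian R (LinearMap.ker (LinearMap.lsmul R N y))) : IsArtinian R N := by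
  rw [← monotone_stabilizes_iff_artinian]
  intro f
  let F : ℕ → Submodule R N := fun j => OrderDual.ofDual (f j)
  have hF : ∀ {i j}, i ≤ j → F j ≤ F i := fun h => f.monotone h
  let K := LinearMap.ker (LinearMap.lsmul R N y)
  let S : ℕ → ℕ → Submodule R K := fun j k => ((F j).map (LinearMap.lsmul R N (y ^ k))).comap K.subtype
  have memS : ∀ j k (z : K), z ∈ S j k ↔ ∃ v ∈ F j, y ^ k • v = z := fun j k z => by
    simp [S, Submodule.mem_map]
  have hS1 : ∀ {i j} k, i ≤ j → S j k ≤ S i k := by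
    intro i j k hij z hz
    rw [memS] at hz ⊢
    obtain ⟨v, hv, h⟩ := hz
    exact ⟨v, hF hij hv, h⟩
  have hS2 : ∀ {k l} j, k ≤ l → S j l ≤ S j k := by
    intro k l j hkl z hz
    rw [memS] at hz ⊢
    obtain ⟨v, hv, h⟩ := hz
    refine ⟨y ^ (l - k) • v, Submodule.smul_mem _ _ hv, ?_⟩
    rw [← mul_smul, ← pow_add, Nat.add_sub_cancel' hkl, h]
  obtain ⟨J, hJ⟩ := IsArtinian.monotone_stabilizes (⟨fun j => OrderDual.toDual (S j j), fun i j hij => 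
    OrderDual.toDual_le_toDual.2 ((hS1 j hij).trans (hS2 i hij))⟩ : ℕ →o (Submodule R K)ᵒᵈ)
  have hk : ∀ k, ∃ n, ∀ m, n ≤ m → S n k = S m k := fun k =>
    IsArtinian.monotone_stabilizes (⟨fun j => OrderDual.toDual (S j k), fun i j hij => 
    OrderDual.toDual_le_toDual.2 ((hS1 k hij))⟩ : ℕ →o (Submodule R K)ᵒᵈ)
  choose c hc using hk
  let J' := J + ∑ k ∈ Finset.range J, c k
  have key : ∀ j, J' ≤ j → ∀ k, S J' k ≤ S j k := by
    intro j hj k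
    by_cases hkJ : k < J
    · have h1 : c k ≤ J' := by
        have := Finset.single_le_sum (f := c) (fun i _ => Nat.zero_le _) (Finset.mem_range.2 hkJ)
        omega
      rw [← hc k J' h1, ← hc k j (h1.trans hj)]
    · have h1 : S J J = S (max j k) (max j k) := hJ (max j k) (by omega)
      calc S J' k ≤ S J k := hS1 k (by omega)
        _ ≤ S J J := hS2 J (by omega)
        _ = S (max j k) (max j k) := h1
        _ ≤ S j (max j k) := hS1 _ (by omega)
        _ ≤ S j k := hS2 _ (by omega)
  refine ⟨J', fun j hj => ?_⟩
  suffices F J' = F j from this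
  refine le_antisymm ?_ (hF hj)
  have main : ∀ k (v : N), v ∈ F J' → y ^ k • v = 0 → v ∈ F j := by
    intro k
    induction k with
    | zero => intro v _ h0; rw [pow_zero, one_smul] at h0; rw [h0]; exact zero_mem _
    | succ k ih =>
      intro v hv h0
      have hz : y ^ k • v ∈ K := by
        rw [LinearMap.mem_ker, LinearMap.lsmul_apply, ← mul_smul, ← pow_succ', h0]
      obtain ⟨w, hw, hwz⟩ := (memS j k ⟨_, hz⟩).1 (key j hj k ((memS _ _ _).2 ⟨v, hv, rfl⟩))
      have := ih (v - w) (sub_mem hv (hF hj hw)) (by rw [smul_sub, hwz, sub_self])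
      simpa using add_mem this hw
  intro v hv
  obtain ⟨t, h0⟩ := ht v
  exact main t v hv h0

lemma sup_pow_le (I J : Ideal R) (t : ℕ) : (I ⊔ J) ^ t ≤ I ^ t ⊔ J := by
  induction t with
  | zero => simp
  | succ t ih =>
    rw [pow_succ, pow_succ]
    refine (Ideal.mul_mono_left ih).trans ?_
    have h1 : I ^ t * J ≤ J := Ideal.mul_le_right
    have h2 : J * (I ⊔ J) ≤ J := Ideal.mul_le_left
    have h3 : (I ^ t ⊔ J) * (I ⊔ J) = I ^ t * I ⊔ I ^ t * J ⊔ J * (I ⊔ J) := by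
      rw [Ideal.sup_mul, Ideal.mul_sup (I ^ t)]
    rw [h3]
    exact sup_le (sup_le le_sup_left (le_trans h1 le_sup_right)) (le_trans h2 le_sup_right)

lemma art_of_ring {M : Type u} [AddCommGroup M] [Module R M] [Module.Finite R M] (I : Ideal R) (hI : I ≤ Module.annihilator R M)
   [IsArtinianRing (R ⧸ I)] : IsArtinian R M := by
  obtain ⟨k, g, hg⟩ := Module.Finite.exists_fin (R := R) (M := M)
  have : IsArtinian R (R ⧸ I) := isArtinian_of_surjective_algebraMap (R := R ⧸ I) Ideal.Quotient.mk_surjective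
  let φ : (Fin k → R ⧸ I) →ₗ[R] M := ∑ j, (I.liftQ (LinearMap.toSpanSingleton R M (g j)) (fun r hr => by
     simpa using Module.mem_annihilator.1 (hI hr) (g j))) ∘ₗ LinearMap.proj j
  refine isArtinian_of_surjective _ φ fun x => ?_
  have : x ∈ Submodule.span R (Set.range g) := by rw [hg]; trivial
  rw [Submodule.mem_span_range_iff_exists_fun] at this
  obtain ⟨c, rfl⟩ := this
  refine ⟨fun j => Ideal.Quotient.mk I (c j), ?_⟩
  simp only [φ, LinearMap.sum_apply]
  rfl


variable [IsNoetherianRing R] [IsLocalRing R]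

lemma art_of_pow {M : Type u} [AddCommGroup M] [Module R M] [Module.Finite R M] (k : ℕ) 
    (hI : IsLocalRing.maximalIdeal R ^ k ≤ Module.annihilator R M) : IsArtinian R M := by
  have : IsArtinianRing (R ⧸ (IsLocalRing.maximalIdeal R ^ (k+1))) := by
    apply IsLocalRing.quotient_artinian_of_mem_minimalPrimes_of_isLocalRing
    refine ⟨⟨inferInstance, Ideal.pow_le_self (by omega)⟩, ?_⟩
    rintro q ⟨hq, hle⟩ -
    exact hq.le_of_pow_le hle
  exact art_of_ring (IsLocalRing.maximalIdeal R ^ (k+1)) ((Ideal.pow_le_pow_right (by omega)).trans hI)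

lemma pow_of_dim {M : Type u} [AddCommGroup M] [Module R M] [Module.Finite R M] 
    (h : Module.supportDim R M ≤ 0) : ∃ k, IsLocalRing.maximalIdeal R ^ k ≤ Module.annihilator R M := by
  rw [Module.supportDim_eq_ringKrullDim_quotient_annihilator] at h
  have h1 : Ring.KrullDimLE 0 (R ⧸ Module.annihilator R M) := Ring.krullDimLE_iff.2 (by simpa using h)
  have : IsArtinianRing (R ⧸ Module.annihilator R M) := IsNoetherianRing.isArtinianRing_of_krullDimLE_zero
  exact IsLocalRing.exists_maximalIdeal_pow_le_of_isArtinianRing_quotient _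

lemma art (a : Ideal R) (i : ℕ) : ∀ (M : Type u) [AddCommGroup M] [Module R M] [Module.Finite R M], 
    (Module.supportDim R M ≤ i ∨ ∃ k, IsLocalRing.maximalIdeal R ^ k ≤ a ⊔ Module.annihilator R M) → IsArtinian R (LC a i M) := by
  induction i with
  | zero =>
    intro M _ _ _ h
    have hk : ∃ k, IsLocalRing.maximalIdeal R ^ k ≤ a ⊔ Module.annihilator R M := by
      rcases h with h | h
      · obtain ⟨k, hk⟩ := pow_of_dim (by simpa using h)
        exact ⟨k, hk.trans le_sup_right⟩
      · exact h
    obtain ⟨k, hk⟩ := hk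
    let G := LinearMap.range (leps a M)
    have hG : G ≤ Gam a M := by
      rintro _ ⟨x, rfl⟩
      obtain ⟨t, ht⟩ := ltors a 0 x
      exact ⟨t, fun r hr => by rw [← map_smul, ht r hr, map_zero]⟩
    obtain ⟨t, ht⟩ := fg_tors a G (IsNoetherian.noetherian _) hG
    have hann : a ^ t ⊔ Module.annihilator R M ≤ Module.annihilator R G := by
      refine sup_le (fun r hr => ?_) (fun r hr => ?_)
      · rw [Module.mem_annihilator]; rintro ⟨x, hx⟩; exact Subtype.ext (ht r hr x hx)
      · rw [Module.mem_annihilator] at hr ⊢; rintro ⟨x, hx⟩; exact Subtype.ext (hr x)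
    have : IsArtinian R G := by
      refine art_of_pow (k * t) (le_trans ?_ hann)
      rw [pow_mul]
      refine (Ideal.pow_right_mono hk t).trans ?_
      exact sup_pow_le _ _ t
    exact isArtinian_of_injective (leps a M).rangeRestrict 
      (by rw [← LinearMap.ker_eq_bot, LinearMap.ker_rangeRestrict, LinearMap.ker_eq_bot]; exact leps_inj a)
  | succ i ih =>
    intro M _ _ _ h
    by_cases ha : a = ⊤
    · have := lc_top a ha (i+1) (M := M)
      infer_instance
    have ham := IsLocalRing.le_maximalIdeal ha
    obtain ⟨y, hy, hreg⟩ := prime_avoid a (gam_gam a (M := M))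
    have hd := Module.supportDim_quotSMulTop_succ_eq_supportDim hreg (ham hy)
    have hd2 := Module.supportDim_le_of_surjective (Gam a M).mkQ (Submodule.mkQ_surjective _)
    have := ih (QuotSMulTop y (M ⧸ Gam a M)) (by
      rcases h with h | ⟨k, hk⟩
      · left
        exact wb_le _ _ (by rw [hd]; exact hd2.trans h)
      · right
        refine ⟨k, hk.trans (sup_le_sup_left ?_ a)⟩
        refine ((Gam a M).mkQ.annihilator_le_of_surjective (Submodule.mkQ_surjective _)).trans ?_
        exact LinearMap.annihilator_le_of_surjective (Submodule.mkQ _) (Submodule.mkQ_surjective _))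
    have h2 : IsArtinian R (LC a (i+1) (M ⧸ Gam a M)) := by
      refine melk y (fun v => ?_) ?_
      · obtain ⟨t, ht⟩ := ltors a (i+1) v
        exact ⟨t, ht _ (Ideal.pow_mem_pow hy t)⟩
      · obtain ⟨δ, -, h2⟩ := reg_les a i y hreg
        rw [LinearMap.exact_iff.1 h2]
        exact isArtinian_of_surjective _ δ.rangeRestrict δ.surjective_rangeRestrict
    exact isArtinian_of_linearEquiv (gamEquiv a i (M := M)).symm

end P11
end LCaux
end

noncomputable section
open scoped Pointwise
namespace LCaux

section P12
variable {R : Type u} [CommRing R]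

lemma exists_E [IsLocalRing R] : ∃ (E : Type u) (_ : AddCommGroup E) (_ : Module R E), Module.Injective R E ∧
    ∃ e : E, e ≠ 0 ∧ (∀ r ∈ IsLocalRing.maximalIdeal R, r • e = 0) ∧ 
      ∀ y : E, (∀ r ∈ IsLocalRing.maximalIdeal R, r • y = 0) → ∃ r : R, y = r • e := by
  obtain ⟨I, _, _, f, hI, hf⟩ := exists_inj_embed (R := R) (R ⧸ IsLocalRing.maximalIdeal R)
  let e : I := f 1
  have he0 : e ≠ 0 := fun h => one_ne_zero (hf (h.trans (map_zero f).symm))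
  have hem : ∀ r ∈ IsLocalRing.maximalIdeal R, r • e = 0 := fun r hr => by
    change r • f 1 = 0
    rw [← map_smul]
    have : r • (1 : R ⧸ IsLocalRing.maximalIdeal R) = 0 := by
      rw [Algebra.smul_def, mul_one]; exact Ideal.Quotient.eq_zero_iff_mem.2 hr
    rw [this, map_zero]
  let S : Set (Submodule R I) := {S | e ∈ S ∧ ∀ x ∈ S, x ≠ 0 → ∃ r : R, r • x ≠ 0 ∧ r • x ∈ R ∙ e}
  have hS0 : (R ∙ e) ∈ S := ⟨Submodule.mem_span_singleton_self e, fun x hx h0 => ⟨1, by rwa [one_smul], by rwa [one_smul]⟩⟩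
  obtain ⟨E, -, hEmax⟩ := zorn_le_nonempty₀ S (by
    intro c hc hch y hy
    refine ⟨sSup c, ⟨Submodule.mem_sSup_of_mem hy (hc hy).1, ?_⟩, fun z hz => le_sSup hz⟩
    intro x hx
    obtain ⟨K, hK, hxK⟩ := (Submodule.mem_sSup_of_directed ⟨y, hy⟩ hch.directedOn).1 hx
    exact (hc hK).2 x hxK) _ hS0
  have hE := hEmax.prop
  obtain ⟨C, -, hCmax⟩ := zorn_le_nonempty₀ {C : Submodule R I | ∀ x ∈ C, x ∈ E → x = 0} (by
    intro c hc hch y hy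
    refine ⟨sSup c, ?_, fun z hz => le_sSup hz⟩
    intro x hx
    obtain ⟨K, hK, hxK⟩ := (Submodule.mem_sSup_of_directed ⟨y, hy⟩ hch.directedOn).1 hx
    exact hc hK x hxK) ⊥ (by intro x hx _; exact (Submodule.mem_bot R).1 hx)
  have hC := hCmax.prop
  obtain ⟨h, hh⟩ := inj_ext hI (C.mkQ ∘ₗ E.subtype) E.subtype (by
    intro x hx
    rw [LinearMap.mem_ker, LinearMap.comp_apply, Submodule.mkQ_apply, Submodule.Quotient.mk_eq_zero] at hx
    rw [LinearMap.mem_ker]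
    exact hC _ hx x.2)
  have hh' : ∀ x ∈ E, h (C.mkQ x) = x := fun x hx => hh ⟨x, hx⟩
  have hker : ∀ z, h (C.mkQ z) = 0 → z ∈ C := by
    intro z hz
    have : LinearMap.ker (h ∘ₗ C.mkQ) ≤ C := by
      apply hCmax.le_of_ge
      · intro x hx hxE
        rw [← hh' x hxE]; exact hx
      · intro x hx
        rw [LinearMap.mem_ker, LinearMap.comp_apply, (by simpa using hx : C.mkQ x = 0), map_zero]
    exact this hz
  have hrange : LinearMap.range (h ∘ₗ C.mkQ) ≤ E := by
    apply hEmax.le_of_ge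
    · refine ⟨⟨e, hh' e hE.1⟩, ?_⟩
      rintro _ ⟨z, rfl⟩ h0
      by_contra hcon
      push Not at hcon
      have hzC : z ∉ C := fun hz => h0 (by rw [LinearMap.comp_apply, (by simpa using hz : C.mkQ z = 0), map_zero])
      refine hzC ((hCmax.le_of_ge (y := C ⊔ R ∙ z) ?_ le_sup_left) (Submodule.mem_sup_right (Submodule.mem_span_singleton_self z)))
      intro w hw hwE
      obtain ⟨c, hc, d, hd, rfl⟩ := Submodule.mem_sup.1 hw
      obtain ⟨r, rfl⟩ := Submodule.mem_span_singleton.1 hd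
      by_contra hw0
      obtain ⟨s, hs1, hs2⟩ := hE.2 _ hwE hw0
      have h3 := hh' _ hwE
      rw [map_add, (by simpa using hc : C.mkQ c = 0), zero_add, map_smul, map_smul] at h3
      rw [← h3, ← mul_smul] at hs1 hs2
      exact hcon (s * r) hs1 hs2
    · intro x hx
      exact ⟨x, hh' x hx⟩
  refine ⟨E, inferInstance, inferInstance, ⟨?_⟩, ⟨e, hE.1⟩, ?_, ?_, ?_⟩
  · intro X Y _ _ _ _ φ hφ g
    obtain ⟨k, hk⟩ := hI.out φ hφ (E.subtype ∘ₗ g)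
    refine ⟨LinearMap.codRestrict E (h ∘ₗ C.mkQ) (fun c => hrange ⟨c, rfl⟩) ∘ₗ k, fun x => Subtype.ext ?_⟩
    change h (C.mkQ (k (φ x))) = g x
    rw [hk]
    exact hh' _ (g x).2
  · intro h0; exact he0 (congrArg Subtype.val h0)
  · intro r hr; exact Subtype.ext (hem r hr)
  · rintro ⟨y, hy⟩ hy2
    by_cases hy0 : y = 0
    · exact ⟨0, Subtype.ext (by simp [hy0])⟩
    obtain ⟨r, hr1, hr2⟩ := hE.2 y hy hy0
    have hru : IsUnit r := by
      by_contra hr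
      exact hr1 (congrArg Subtype.val (hy2 r hr))
    obtain ⟨s, hs⟩ := Submodule.mem_span_singleton.1 hr2
    obtain ⟨v, hv⟩ := hru.exists_left_inv
    refine ⟨v * s, Subtype.ext ?_⟩
    change y = (v * s) • e
    rw [mul_smul, hs, ← mul_smul, hv, one_smul]

end P12
end LCaux
end

noncomputable section
open scoped Pointwise
namespace LCaux

section P13
variable {R : Type u} [CommRing R] [IsLocalRing R]

structure IsME (R : Type u) [CommRing R] [IsLocalRing R] (E : Type u) [AddCommGroup E] [Module R E] : Prop where
  inj : Module.Injective R E
  soc : ∃ e : E, e ≠ 0 ∧ (∀ r ∈ IsLocalRing.maximalIdeal R, r • e = 0) ∧ 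
      ∀ y : E, (∀ r ∈ IsLocalRing.maximalIdeal R, r • y = 0) → ∃ r : R, y = r • e

variable {E : Type u} [AddCommGroup E] [Module R E]
variable {N : Type u} [AddCommGroup N] [Module R N] 

open IsLocalRing

lemma art_tors [IsNoetherianRing R] [IsArtinian R N] (x : N) : ∃ t, ∀ r ∈ maximalIdeal R ^ t, r • x = 0 := by
  obtain ⟨t, ht⟩ := IsArtinian.monotone_stabilizes (⟨fun i => OrderDual.toDual (maximalIdeal R ^ i • (R ∙ x)), fun i j hij => 
    OrderDual.toDual_le_toDual.2 (Submodule.smul_mono_left (Ideal.pow_le_pow_right hij))⟩ : ℕ →o (Submodule R N)ᵒᵈ)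
  have h1 : maximalIdeal R ^ t • (R ∙ x) = maximalIdeal R ^ (t+1) • (R ∙ x) := ht (t+1) (by omega)
  have h2 : maximalIdeal R ^ t • (R ∙ x) = ⊥ := by
    apply Submodule.eq_bot_of_le_smul_of_le_jacobson_bot (maximalIdeal R)
    · exact Submodule.FG.smul (IsNoetherian.noetherian _) (Submodule.fg_span_singleton x)
    · rw [← Submodule.mul_smul, ← pow_succ', ← h1]
    · exact IsLocalRing.maximalIdeal_le_jacobson _
  refine ⟨t, fun r hr => ?_⟩
  rw [← Submodule.mem_bot R, ← h2]
  exact Submodule.smul_mem_smul hr (Submodule.mem_span_singleton_self x)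

lemma exists_soc (x : N) (hx : x ≠ 0) (t : ℕ) (ht : ∀ r ∈ maximalIdeal R ^ t, r • x = 0) : 
    ∃ z : N, z ≠ 0 ∧ ∀ r ∈ maximalIdeal R, r • z = 0 := by
  induction t generalizing x with
  | zero => exact absurd (by simpa using ht 1 (by simp)) hx
  | succ t ih =>
    by_cases h : ∀ r ∈ maximalIdeal R, r • x = 0
    · exact ⟨x, hx, h⟩
    · push Not at h
      obtain ⟨r, hr, hrx⟩ := h
      refine ih (r • x) hrx fun s hs => ?_
      rw [← mul_smul]
      exact ht _ (by rw [pow_succ]; exact Ideal.mul_mem_mul hs hr)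

lemma dual_ne (hE : IsME R E) [IsNoetherianRing R] [IsArtinian R N] [Nontrivial N] : ∃ τ : N →ₗ[R] E, τ ≠ 0 := by
  obtain ⟨x, hx⟩ := exists_ne (0 : N)
  obtain ⟨t, ht⟩ := art_tors (R := R) x
  obtain ⟨z, hz, hzm⟩ := exists_soc x hx t ht
  obtain ⟨e, he, hem, -⟩ := hE.soc
  obtain ⟨k, hk⟩ := inj_ext hE.inj (LinearMap.toSpanSingleton R N z) (LinearMap.toSpanSingleton R E e) (by
    intro r hr
    rw [LinearMap.mem_ker, LinearMap.toSpanSingleton_apply] at hr ⊢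
    apply hem
    intro hu
    obtain ⟨v, hv⟩ := IsUnit.exists_left_inv hu
    exact hz (by rw [← one_smul R z, ← hv, mul_smul, hr, smul_zero]))
  refine ⟨k, fun h0 => he ?_⟩
  have := hk 1
  simpa [h0] using this.symm

lemma dual_ker (hE : IsME R E) [IsNoetherianRing R] (J : Ideal R) (τ : N →ₗ[R] E) (h : ∀ v, (∀ r ∈ J, r • v = 0) → τ v = 0) :
    τ ∈ J • (⊤ : Submodule R (N →ₗ[R] E)) := by
  obtain ⟨k, r, hr⟩ := Submodule.fg_iff_exists_fin_generating_family.1 (IsNoetherian.noetherian J)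
  have hrJ : ∀ j, r j ∈ J := fun j => hr ▸ Submodule.subset_span ⟨j, rfl⟩
  obtain ⟨κ, hκ⟩ := inj_ext hE.inj (LinearMap.pi fun j => LinearMap.lsmul R N (r j)) τ (by
    intro v hv
    rw [LinearMap.mem_ker] at hv ⊢
    have hv' : ∀ j, r j • v = 0 := fun j => congrFun hv j
    apply h
    intro s hs
    rw [← hr, Submodule.mem_span_range_iff_exists_fun] at hs
    obtain ⟨c, rfl⟩ := hs
    rw [Finset.sum_smul]
    refine Finset.sum_eq_zero fun j _ => ?_
    rw [smul_eq_mul, mul_smul, hv', smul_zero])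
  have : τ = ∑ j, r j • (κ ∘ₗ LinearMap.single R (fun _ => N) j) := by
    ext v
    rw [← hκ v, LinearMap.sum_apply]
    conv_lhs => rw [← Finset.univ_sum_single ((LinearMap.pi fun j => LinearMap.lsmul R N (r j)) v), map_sum]
    refine Finset.sum_congr rfl fun j _ => ?_
    rw [LinearMap.smul_apply, LinearMap.comp_apply, ← map_smul, ← map_smul]
    rfl
  rw [this]
  exact Submodule.sum_mem _ fun j _ => Submodule.smul_mem_smul (hrJ j) trivial

lemma dual_ker' (J : Ideal R) (τ : N →ₗ[R] E) (h : τ ∈ J • (⊤ : Submodule R (N →ₗ[R] E))) (v : N) 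
    (hv : ∀ r ∈ J, r • v = 0) : τ v = 0 := by
  refine Submodule.smul_induction_on h (fun r hr σ _ => ?_) (fun σ ρ h1 h2 => by rw [LinearMap.add_apply, h1, h2, add_zero])
  rw [LinearMap.smul_apply, ← map_smul, hv r hr, map_zero]

instance dual_haus [IsNoetherianRing R] [IsArtinian R N] : IsHausdorff (maximalIdeal R) (N →ₗ[R] E) where
  haus' := by
    intro τ h
    ext v
    obtain ⟨t, ht⟩ := art_tors (R := R) v
    exact dual_ker' _ τ (SModEq.zero.1 (h t)) v ht

lemma mem_pow_pi (k : ℕ) (I : Ideal R) (x : Fin k → R) : x ∈ I • (⊤ : Submodule R (Fin k → R)) ↔ ∀ j, x j ∈ I := by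
  constructor
  · intro h j
    refine Submodule.smul_induction_on h (fun r hr σ _ => ?_) (fun σ ρ h1 h2 => add_mem h1 h2)
    exact I.mul_mem_right _ hr
  · intro h
    have : x = ∑ j, x j • (Pi.single j (1 : R) : Fin k → R) := by
      ext i; simp [Finset.sum_apply, Pi.single_apply]
    rw [this]
    exact Submodule.sum_mem _ fun j _ => Submodule.smul_mem_smul (h j) trivial

lemma prec_pi (k : ℕ) (I : Ideal R) [IsPrecomplete I R] : IsPrecomplete I (Fin k → R) where
  prec' := by
    intro f hf
    have : ∀ j, ∃ L : R, ∀ n, f n j ≡ L [SMOD (I ^ n • ⊤ : Submodule R R)] := fun j => by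
      refine IsPrecomplete.prec' (fun n => f n j) fun {m n} hmn => ?_
      have := hf hmn
      rw [SModEq.sub_mem, mem_pow_pi] at this
      rw [SModEq.sub_mem]
      simpa using this j
    choose L hL using this
    refine ⟨L, fun n => ?_⟩
    rw [SModEq.sub_mem, mem_pow_pi]
    intro j
    have := hL j n
    rw [SModEq.sub_mem] at this
    simpa using this

lemma soc_fg (V : Type u) [AddCommGroup V] [Module R V] [IsArtinian R V] (h : ∀ r ∈ maximalIdeal R, ∀ v : V, r • v = 0) : 
    Module.Finite R V := by
  letI : Module (R ⧸ maximalIdeal R) V := Module.IsTorsionBySet.module (I := maximalIdeal R) (fun v r => h r r.2 v)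
  haveI : IsScalarTower R (R ⧸ maximalIdeal R) V := Module.IsTorsionBySet.isScalarTower (I := maximalIdeal R) (fun v r => h r r.2 v)
  letI : Field (R ⧸ maximalIdeal R) := Ideal.Quotient.field _
  have h1 : IsArtinian (R ⧸ maximalIdeal R) V := isArtinian_of_tower R inferInstance
  have h2 : Module.Finite (R ⧸ maximalIdeal R) V := by
    have := (IsSemiprimaryRing.isNoetherian_iff_isArtinian (R := R ⧸ maximalIdeal R) (M := V)).2 h1
    infer_instance
  exact Module.Finite.trans (R ⧸ maximalIdeal R) V

lemma dual_fg (hE : IsME R E) [IsNoetherianRing R] [IsAdicComplete (maximalIdeal R) R] [IsArtinian R N] : Module.Finite R (N →ₗ[R] E) := by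
  let V : Submodule R N := 
    { carrier := {v | ∀ r ∈ maximalIdeal R, r • v = 0}
      zero_mem' := fun r _ => smul_zero r
      add_mem' := fun {x y} hx hy r hr => by rw [smul_add, hx r hr, hy r hr, add_zero]
      smul_mem' := fun c x hx r hr => by rw [smul_comm, hx r hr, smul_zero] }
  have hV : Module.Finite R V := soc_fg V fun r hr v => Subtype.ext (v.2 r hr)
  obtain ⟨k, v, hv⟩ := Module.Finite.exists_fin (R := R) (M := V)
  obtain ⟨e, he, hem, hes⟩ := hE.soc
  let ρ : (N →ₗ[R] E) →ₗ[R] (Fin k → (R ∙ e)) := 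
    LinearMap.pi fun j => LinearMap.codRestrict (R ∙ e) (LinearMap.applyₗ (v j : N)) (fun τ => by
      obtain ⟨r, hr⟩ := hes (τ (v j)) (fun r hr => by rw [← map_smul, (v j).2 r hr, map_zero])
      exact Submodule.mem_span_singleton.2 ⟨r, hr.symm⟩)
  have hker : ∀ τ, ρ τ = 0 → τ ∈ maximalIdeal R • (⊤ : Submodule R (N →ₗ[R] E)) := by
    intro τ hτ
    refine dual_ker hE _ τ fun w hw => ?_
    have hτ' : ∀ j, τ (v j) = 0 := fun j => congrArg Subtype.val (congrFun hτ j)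
    have : (⟨w, hw⟩ : V) ∈ Submodule.span R (Set.range v) := by rw [hv]; trivial
    rw [Submodule.mem_span_range_iff_exists_fun] at this
    obtain ⟨c, hc⟩ := this
    have hc' : w = ∑ j, c j • (v j : N) := by
      have := congrArg V.subtype hc
      rw [map_sum] at this
      exact this.symm
    rw [hc', map_sum]
    refine Finset.sum_eq_zero fun j _ => ?_
    rw [map_smul, hτ', smul_zero]
  obtain ⟨l, g, hg⟩ := Submodule.fg_iff_exists_fin_generating_family.1 (IsNoetherian.noetherian (LinearMap.range ρ))
  have hgr : ∀ j, ∃ τ, ρ τ = g j := fun j => by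
    have : g j ∈ LinearMap.range ρ := hg ▸ Submodule.subset_span ⟨j, rfl⟩
    exact this
  choose τ hτ using hgr
  let φ : (Fin l → R) →ₗ[R] (N →ₗ[R] E) := ∑ j, (LinearMap.toSpanSingleton R _ (τ j)) ∘ₗ LinearMap.proj j
  have hφ : ∀ c, φ c = ∑ j, c j • τ j := fun c => by simp [φ]
  have := prec_pi l (maximalIdeal R)
  have := dual_haus (R := R) (E := E) (N := N)
  refine Module.Finite.of_surjective φ (surjective_of_mkQ_comp_surjective (I := maximalIdeal R) ?_)
  intro x
  obtain ⟨σ, rfl⟩ := Submodule.mkQ_surjective _ x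
  have : ρ σ ∈ Submodule.span R (Set.range g) := by rw [hg]; exact ⟨σ, rfl⟩
  rw [Submodule.mem_span_range_iff_exists_fun] at this
  obtain ⟨c, hc⟩ := this
  refine ⟨c, ?_⟩
  rw [LinearMap.comp_apply, ← sub_eq_zero, ← map_sub, ← LinearMap.mem_ker, Submodule.ker_mkQ]
  apply hker
  rw [map_sub, hφ, map_sum, sub_eq_zero, ← hc]
  exact Finset.sum_congr rfl fun j _ => by rw [map_smul, hτ]

end P13
end LCaux
end

noncomputable section
open scoped Pointwise
namespace LCaux

section P14
variable {R : Type u} [CommRing R] [IsNoetherianRing R]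
open IsLocalRing

lemma min_key (A Q : Ideal R) (hI : Q ∈ A.minimalPrimes) : ∃ n : ℕ, ∃ s, s ∉ Q ∧ ∀ q ∈ Q ^ n, q * s ∈ A := by
  classical
  obtain ⟨n, hn⟩ := A.exists_radical_pow_le_of_fg A.radical.fg_of_isNoetherianRing
  have h := A.finite_minimalPrimes_of_isNoetherianRing R
  rw [← A.sInf_minimalPrimes, ← h.coe_toFinset, ← h.toFinset.inf_id_eq_sInf,
      ← Finset.insert_erase (h.mem_toFinset.mpr hI), Finset.inf_insert, id_eq] at hn
  have hn2 : Q ^ n * ((h.toFinset.erase Q).inf id) ^ n ≤ A := by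
    rw [← mul_pow]
    exact (Ideal.pow_right_mono Ideal.mul_le_inf n).trans hn
  have hJ : ¬ ((h.toFinset.erase Q).inf id) ^ n ≤ Q := by
    intro hle
    have := hI.1.1.le_of_pow_le hle
    rw [Ideal.IsPrime.inf_le' hI.1.1] at this
    obtain ⟨K, hK, hKQ⟩ := this
    rw [Finset.mem_erase, h.mem_toFinset] at hK
    exact hK.1 (le_antisymm hKQ (hI.2 hK.2.1 hKQ))
  obtain ⟨s, hs, hsQ⟩ := SetLike.not_le_iff_exists.1 hJ
  exact ⟨n, s, hsQ, fun q hq => hn2 (Ideal.mul_mem_mul hq hs)⟩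

variable [IsLocalRing R]

lemma dim_quot_prime (p : Ideal R) [hp : p.IsPrime] (h : Module.supportDim R (R ⧸ p) ≤ 0) : p = maximalIdeal R := by
  obtain ⟨k, hk⟩ := pow_of_dim h
  rw [Ideal.annihilator_quotient] at hk
  exact le_antisymm (le_maximalIdeal hp.ne_top) (hp.le_of_pow_le hk)

lemma reg_quot (p : Ideal R) [hp : p.IsPrime] (y : R) (hy : y ∉ p) : IsSMulRegular (R ⧸ p) y := by
  rw [isSMulRegular_iff_right_eq_zero_of_smul]
  intro x hx
  obtain ⟨x, rfl⟩ := Ideal.Quotient.mk_surjective x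
  have : Ideal.Quotient.mk p (y * x) = 0 := hx
  rw [Ideal.Quotient.eq_zero_iff_mem] at this ⊢
  exact (hp.mem_or_mem this).resolve_left hy

/-- multiplication by a regular element is surjective on top local cohomology -/
lemma reg_smul_surj (a : Ideal R) (n : ℕ) {M : Type u} [AddCommGroup M] [Module R M] [Module.Finite R M] 
    (hM : Module.supportDim R M ≤ (n + 1 : ℕ))
    (r : R) (hr : IsSMulRegular M r) (u : LC a (n+1) M) : ∃ v, r • v = u := by
  by_cases hrm : r ∈ maximalIdeal R
  · refine elt_smul_top a (n+1) hM r ?_ u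
    apply van
    have hd := Module.supportDim_quotSMulTop_succ_eq_supportDim hr hrm
    exact wb_lt_of_le _ _ (wb_le _ _ (hd ▸ hM))
  · obtain ⟨v, hv⟩ := (not_not.1 hrm : IsUnit r).exists_right_inv
    exact ⟨v • u, by rw [← mul_smul, hv, one_smul]⟩

lemma le_ann_quot (I : Ideal R) (M : Type u) [AddCommGroup M] [Module R M] : I ≤ Module.annihilator R (M ⧸ I • (⊤ : Submodule R M)) := by
  intro r hr
  rw [Module.mem_annihilator]
  intro x
  obtain ⟨x, rfl⟩ := Submodule.mkQ_surjective _ x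
  rw [← map_smul, Submodule.mkQ_apply, Submodule.Quotient.mk_eq_zero]
  exact Submodule.smul_mem_smul hr trivial

lemma ann_quotSMulTop_mem (p : Ideal R) (y r : R) (h : r ∈ Module.annihilator R (QuotSMulTop y (R ⧸ p))) :
    r ∈ p ⊔ Ideal.span {y} := by
  rw [Module.mem_annihilator] at h
  have h1 := h ((y • (⊤ : Submodule R (R ⧸ p))).mkQ (Ideal.Quotient.mk p 1))
  rw [← map_smul, Submodule.mkQ_apply, Submodule.Quotient.mk_eq_zero] at h1
  obtain ⟨w, -, hw⟩ := h1
  obtain ⟨w, rfl⟩ := Ideal.Quotient.mk_surjective w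
  have h2 : Ideal.Quotient.mk p (y * w) = Ideal.Quotient.mk p (r * 1) := hw
  rw [eq_comm, Ideal.Quotient.eq, mul_one] at h2
  have : r = (r - y * w) + y * w := by ring
  rw [this]
  exact add_mem (Ideal.mem_sup_left h2) (Ideal.mem_sup_right (Ideal.mul_mem_right _ _ (Ideal.mem_span_singleton_self y)))

lemma ann_quotSMulTop_le (p : Ideal R) (y : R) (M : Type u) [AddCommGroup M] [Module R M] (h : p ≤ Module.annihilator R M) : 
    p ⊔ Ideal.span {y} ≤ Module.annihilator R (QuotSMulTop y M) := by
  refine sup_le (h.trans (LinearMap.annihilator_le_of_surjective _ (Submodule.mkQ_surjective (y • (⊤ : Submodule R M))))) ?_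
  rw [Ideal.span_singleton_le_iff_mem, Module.mem_annihilator]
  intro x
  obtain ⟨x, rfl⟩ := Submodule.mkQ_surjective _ x
  rw [← map_smul, Submodule.mkQ_apply, Submodule.Quotient.mk_eq_zero]
  exact Submodule.smul_mem_pointwise_smul _ _ _ trivial

lemma hlvt_step [IsAdicComplete (maximalIdeal R) R] (a : Ideal R) (n : ℕ) (p P : Ideal R) [hp : p.IsPrime] [hP : P.IsPrime]
    (hd : Module.supportDim R (R ⧸ p) ≤ (n + 1 : ℕ)) (haP : a ≤ P) (hpP : p ≤ P) 
    (IH : ∀ (Q : Ideal R) [Q.IsPrime], Q ≤ P → Module.supportDim R (R ⧸ Q) ≤ n → Subsingleton (LC a n (R ⧸ Q))) :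
    Subsingleton (LC a (n+1) (R ⧸ p)) := by
  by_cases hap : a ≤ p
  · apply ltors_sub
    rw [eq_top_iff]
    intro x _
    rw [mem_Gam]
    refine ⟨1, fun r hr => ?_⟩
    rw [pow_one] at hr
    have : r ∈ Module.annihilator R (R ⧸ p) := by rw [Ideal.annihilator_quotient]; exact hap hr
    exact Module.mem_annihilator.1 this x
  obtain ⟨y, hya, hyp⟩ := SetLike.not_le_iff_exists.1 hap
  have hreg := reg_quot p y hyp
  have hym : y ∈ maximalIdeal R := le_maximalIdeal hP.ne_top (haP hya)
  have hle : p ⊔ Ideal.span {y} ≤ P := sup_le hpP ((Ideal.span_singleton_le_iff_mem _).2 (haP hya))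
  obtain ⟨Q, hQ, hQP⟩ := Ideal.exists_minimalPrimes_le hle
  have hQp : Q.IsPrime := hQ.1.1
  have hQle : p ⊔ Ideal.span {y} ≤ Q := hQ.1.2
  have hdB : Module.supportDim R (QuotSMulTop y (R ⧸ p)) ≤ n := 
    wb_le _ _ ((Module.supportDim_quotSMulTop_succ_eq_supportDim hreg hym) ▸ hd)
  have hdQ : Module.supportDim R (R ⧸ Q) ≤ n := 
    (sdim_ann (by rw [Ideal.annihilator_quotient]; exact fun r hr => hQle (ann_quotSMulTop_mem p y r hr))).trans hdB
  have h0 := IH Q hQP hdQ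
  have hW : Q • (⊤ : Submodule R (LC a n (QuotSMulTop y (R ⧸ p)))) = ⊤ := 
    ideal_smul_top a n hdB Q (lc_of_quot a n Q hdQ h0 (le_ann_quot _ _))
  have hWj : ∀ j, Q ^ j • (⊤ : Submodule R (LC a n (QuotSMulTop y (R ⧸ p)))) = ⊤ := by
    intro j
    induction j with
    | zero => simp
    | succ j ih => rw [pow_succ, Submodule.mul_smul, hW, ih]
  obtain ⟨j, s, hsQ, hs⟩ := min_key _ _ hQ
  have hsW : ∀ w : LC a n (QuotSMulTop y (R ⧸ p)), s • w = 0 := by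
    intro w
    have : w ∈ Q ^ j • (⊤ : Submodule R (LC a n (QuotSMulTop y (R ⧸ p)))) := by rw [hWj]; trivial
    refine Submodule.smul_induction_on this (fun q hq v _ => ?_) (fun v w h1 h2 => by rw [smul_add, h1, h2, add_zero])
    rw [← mul_smul, mul_comm]
    exact lc_ann a n _ (ann_quotSMulTop_le p y _ (by rw [Ideal.annihilator_quotient]) (hs q hq)) v
  by_contra hN
  rw [not_subsingleton_iff_nontrivial] at hN
  obtain ⟨E, _, _, hEi, hEs⟩ := exists_E (R := R)
  have hE : IsME R E := ⟨hEi, hEs⟩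
  have hart : IsArtinian R (LC a (n+1) (R ⧸ p)) := art a (n+1) _ (Or.inl hd)
  have hfin : Module.Finite R (LC a (n+1) (R ⧸ p) →ₗ[R] E) := dual_fg hE
  obtain ⟨τ₀, hτ₀⟩ := dual_ne (N := LC a (n+1) (R ⧸ p)) hE
  have hann : Module.annihilator R (LC a (n+1) (R ⧸ p) →ₗ[R] E) ≤ p := by
    intro r hr
    by_contra hrp
    refine hτ₀ (LinearMap.ext fun u => ?_)
    obtain ⟨v, rfl⟩ := reg_smul_surj a n hd r (reg_quot p r hrp) u
    have := congrArg (fun f => f v) (Module.mem_annihilator.1 hr τ₀)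
    rw [map_smul]
    exact this
  have hsann : s ∈ Module.annihilator R (QuotSMulTop y (LC a (n+1) (R ⧸ p) →ₗ[R] E)) := by
    rw [Module.mem_annihilator]
    intro τ
    obtain ⟨τ, rfl⟩ := Submodule.mkQ_surjective _ τ
    rw [← map_smul, Submodule.mkQ_apply, Submodule.Quotient.mk_eq_zero]
    obtain ⟨δ, -, hδ⟩ := reg_les a n y hreg
    obtain ⟨σ, hσ⟩ := inj_ext hEi (LinearMap.lsmul R (LC a (n+1) (R ⧸ p)) y) (s • τ) (by
      intro v hv
      obtain ⟨w, rfl⟩ := (hδ v).1 hv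
      rw [LinearMap.mem_ker, LinearMap.smul_apply, ← map_smul, ← map_smul, hsW, map_zero, map_zero])
    refine ⟨σ, trivial, LinearMap.ext fun v => ?_⟩
    rw [← hσ]
    change y • σ v = σ (y • v)
    rw [map_smul]
  have hmem : (⟨Q, hQp⟩ : PrimeSpectrum R) ∈ Module.support R (QuotSMulTop y (LC a (n+1) (R ⧸ p) →ₗ[R] E)) := by
    rw [Module.support_quotSMulTop]
    refine ⟨Module.mem_support_iff_of_finite.2 (hann.trans (le_sup_left.trans hQle)), ?_⟩
    rw [PrimeSpectrum.mem_zeroLocus, Set.singleton_subset_iff]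
    exact hQle (Ideal.mem_sup_right (Ideal.mem_span_singleton_self y))
  exact hsQ (Module.annihilator_le_of_mem_support hmem hsann)

lemma hlvt [IsAdicComplete (maximalIdeal R) R] (a : Ideal R) (n : ℕ) : ∀ (p P : Ideal R) [p.IsPrime] [P.IsPrime], 
    Module.supportDim R (R ⧸ p) ≤ (n + 1 : ℕ) → a ≤ P → p ≤ P → P ≠ maximalIdeal R → 
    Subsingleton (LC a (n+1) (R ⧸ p)) := by
  induction n with
  | zero => 
    intro p P _ hP hd haP hpP hPm
    refine hlvt_step a 0 p P hd haP hpP fun Q hQ hQP hdQ => ?_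
    have := dim_quot_prime Q (by simpa using hdQ)
    exact absurd (le_antisymm (le_maximalIdeal hP.ne_top) (this ▸ hQP)) hPm
  | succ n ih => 
    intro p P _ hP hd haP hpP hPm
    exact hlvt_step a (n+1) p P hd haP hpP fun Q hQ hQP hdQ => ih Q P hdQ haP hQP hPm

end P14
end LCaux
end

noncomputable section
open scoped Pointwise
namespace LCaux

section P15
variable {R : Type u} [CommRing R] [IsNoetherianRing R] [IsLocalRing R]
open IsLocalRing

lemma dim_gam (j n : ℕ) (X Y : Type u) [AddCommGroup X] [Module R X] [Module.Finite R X] 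
    [AddCommGroup Y] [Module R Y] [Module.Finite R Y]
    (h : ∀ r ∈ maximalIdeal R ^ j, ∀ s ∈ Module.annihilator R Y, r * s ∈ Module.annihilator R X)
    (hd : ((n + 1 : ℕ) : WithBot ℕ∞) ≤ Module.supportDim R X) : ((n + 1 : ℕ) : WithBot ℕ∞) ≤ Module.supportDim R Y := by
  unfold Module.supportDim at hd ⊢
  have h1 := (Order.le_krullDim_iff (n := n + 1) (α := Module.support R X)).1 hd
  obtain ⟨l, hl⟩ := h1
  refine (Order.le_krullDim_iff (n := n + 1)).2 ?_
  have hY0 : Module.annihilator R Y ≤ (l 0).1.asIdeal := by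
    intro s hs
    have hpr := (l 0).1.isPrime
    by_contra hsn
    have hX := Module.mem_support_iff_of_finite.1 (l 0).2
    have hm : maximalIdeal R ^ j ≤ (l 0).1.asIdeal := fun r hr => 
      (hpr.mem_or_mem (hX (h r hr s hs))).resolve_right hsn
    have hm' := hpr.le_of_pow_le hm
    have hlt : l 0 < l (Fin.last _) := l.strictMono (by
      rw [Fin.lt_def]; simp; omega)
    have : (l 0).1.asIdeal < (l (Fin.last _)).1.asIdeal := hlt
    exact this.not_ge ((le_maximalIdeal (l (Fin.last _)).1.isPrime.ne_top).trans hm')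
  have hY : ∀ i, (l i).1 ∈ Module.support R Y := fun i => 
    Module.mem_support_iff_of_finite.2 (hY0.trans (l.monotone (Fin.zero_le i) : (l 0).1 ≤ (l i).1))
  exact ⟨⟨l.length, fun i => ⟨(l i).1, hY i⟩, fun i => l.step i⟩, hl⟩

lemma gam_kill (a : Ideal R) (X : Type u) [AddCommGroup X] [Module R X] [Module.Finite R X] 
    (k : ℕ) (hk : maximalIdeal R ^ k ≤ a ⊔ Module.annihilator R X) : 
    ∃ j, ∀ r ∈ maximalIdeal R ^ j, ∀ s ∈ Module.annihilator R (X ⧸ Gam a X), r * s ∈ Module.annihilator R X := by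
  obtain ⟨t, ht⟩ := fg_tors a (Gam a X) (IsNoetherian.noetherian _) le_rfl
  refine ⟨k * t, fun r hr s hs => ?_⟩
  have hr2 : r ∈ a ^ t ⊔ Module.annihilator R X := 
    sup_pow_le _ _ t (Ideal.pow_right_mono hk t (by rwa [pow_mul] at hr))
  obtain ⟨c, hc, d, hd, rfl⟩ := Submodule.mem_sup.1 hr2
  rw [Module.mem_annihilator] at hd hs ⊢
  intro x
  have h1 := hs ((Gam a X).mkQ x)
  rw [← map_smul, Submodule.mkQ_apply, Submodule.Quotient.mk_eq_zero] at h1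
  rw [mul_smul, add_smul, hd, ht c hc _ h1, add_zero]

lemma nonvan_step [IsAdicComplete (maximalIdeal R) R] (a : Ideal R) (ha : a ≤ maximalIdeal R) (n : ℕ) 
    (IH : ∀ (X : Type u) [AddCommGroup X] [Module R X] [Module.Finite R X], 
      Module.supportDim R X = n → (∃ k, maximalIdeal R ^ k ≤ a ⊔ Module.annihilator R X) → Nontrivial (LC a n X))
    (X : Type u) [AddCommGroup X] [Module R X] [Module.Finite R X] (hX : Module.supportDim R X = (n + 1 : ℕ))
    (hk : ∃ k, maximalIdeal R ^ k ≤ a ⊔ Module.annihilator R X) (hG : Gam a X = ⊥) : Nontrivial (LC a (n+1) X) := by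
  by_contra hN
  rw [not_nontrivial_iff_subsingleton] at hN
  have hq : ∀ y ∈ maximalIdeal R, IsSMulRegular X y → Module.supportDim R (QuotSMulTop y X) = n := fun y hy hr => 
    wb_eq _ _ ((Module.supportDim_quotSMulTop_succ_eq_supportDim hr hy).trans hX)
  have hnt : ∀ y ∈ maximalIdeal R, IsSMulRegular X y → Nontrivial (LC a n (QuotSMulTop y X)) := fun y hy hr => by
    obtain ⟨k, hk⟩ := hk
    exact IH _ (hq y hy hr) ⟨k, hk.trans (sup_le_sup_left (le_sup_left.trans (ann_quotSMulTop_le _ y X le_rfl)) _)⟩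
  have hsurj : ∀ y, IsSMulRegular X y → Function.Surjective (lmap a n (y • (⊤ : Submodule R X)).mkQ) := fun y hr => by
    obtain ⟨δ, h1, -⟩ := reg_les a n y hr
    intro w
    exact (h1 w).1 (Subsingleton.elim _ _)
  obtain ⟨y, hya, hy⟩ := prime_avoid a hG
  rcases n with _ | n
  · have h0 : Subsingleton (LC a 0 X) := by
      refine subsingleton_of_forall_eq 0 fun u => leps_inj a ?_
      rw [map_zero, ← Submodule.mem_bot R, ← hG, mem_Gam]
      obtain ⟨t, ht⟩ := ltors a 0 u
      exact ⟨t, fun r hr => by rw [← map_smul, ht r hr, map_zero]⟩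
    have h1 := hnt y (ha hya) hy
    exact not_subsingleton _ ((hsurj y hy).subsingleton)
  · obtain ⟨E, _, _, hEi, hEs⟩ := exists_E (R := R)
    have hE : IsME R E := ⟨hEi, hEs⟩
    have hart : IsArtinian R (LC a (n+1) X) := art a (n+1) _ (Or.inr hk)
    have hfin : Module.Finite R (LC a (n+1) X →ₗ[R] E) := dual_fg hE
    have hT : Gam (maximalIdeal R) (LC a (n+1) X →ₗ[R] E) = ⊥ := by
      rw [eq_bot_iff]
      intro τ₀ hτ
      by_contra hne
      obtain ⟨t, ht⟩ := (mem_Gam _).1 hτ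
      obtain ⟨τ, hτ0, hτm⟩ := exists_soc τ₀ (by simpa using hne) t ht
      apply hτ0
      obtain ⟨z, hza, hz⟩ := prime_avoid a (gam_gam a (M := QuotSMulTop y X))
      have hdd : Module.supportDim R (QuotSMulTop y X ⧸ Gam a (QuotSMulTop y X)) ≤ (n + 1 : ℕ) := 
        (Module.supportDim_le_of_surjective _ (Submodule.mkQ_surjective _)).trans (hq y (ha hya) hy).le
      ext u
      obtain ⟨w, hw⟩ := reg_smul_surj a n hdd z hz (gamEquiv a n (lmap a (n+1) (y • (⊤ : Submodule R X)).mkQ u))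
      obtain ⟨w, rfl⟩ := (gamEquiv a n).surjective w
      rw [← map_smul] at hw
      have hw := (gamEquiv a n).injective hw
      obtain ⟨v, rfl⟩ := hsurj y hy w
      rw [← map_smul, eq_comm, ← sub_eq_zero, ← map_sub] at hw
      obtain ⟨v', hv'⟩ := (reg_mid a (n+1) y hy _).1 hw
      have : u = y • v' + z • v := by
        have : y • v' = u - z • v := hv'
        rw [this, sub_add_cancel]
      have e1 := congrArg (fun f => f v') (hτm y (ha hya))
      have e2 := congrArg (fun f => f v) (hτm z (ha hza))
      simp only [LinearMap.smul_apply, LinearMap.zero_apply] at e1 e2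
      rw [this, map_add, map_smul, map_smul, e1, e2, add_zero, LinearMap.zero_apply]
    have hXT : Gam (maximalIdeal R) (X × (LC a (n+1) X →ₗ[R] E)) = ⊥ := by
      rw [eq_bot_iff]
      rintro ⟨x, τ⟩ h
      obtain ⟨t, ht⟩ := (mem_Gam _).1 h
      have h1 : x = 0 := by
        rw [← Submodule.mem_bot R, ← hG, mem_Gam]
        exact ⟨t, fun r hr => congrArg Prod.fst (ht r (Ideal.pow_right_mono ha t hr))⟩
      have h2 : τ = 0 := by
        rw [← Submodule.mem_bot R, ← hT, mem_Gam]
        exact ⟨t, fun r hr => congrArg Prod.snd (ht r hr)⟩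
      rw [h1, h2]; exact zero_mem _
    obtain ⟨w, hwm, hw⟩ := prime_avoid _ hXT
    have hwX : IsSMulRegular X w := by
      rw [isSMulRegular_iff_right_eq_zero_of_smul] at hw ⊢
      intro x hx
      exact congrArg Prod.fst (hw (x, 0) (Prod.ext hx (smul_zero w)))
    have hwT : IsSMulRegular (LC a (n+1) X →ₗ[R] E) w := by
      rw [isSMulRegular_iff_right_eq_zero_of_smul] at hw ⊢
      intro x hx
      exact congrArg Prod.snd (hw (0, x) (Prod.ext (smul_zero w) hx))
    have h1 := hnt w hwm hwX
    have hart2 : IsArtinian R (LC a (n+1) (QuotSMulTop w X)) := isArtinian_of_surjective _ _ (hsurj w hwX)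
    obtain ⟨τ, hτ⟩ := dual_ne (N := LC a (n+1) (QuotSMulTop w X)) hE
    have h2 : τ ∘ₗ lmap a (n+1) (w • (⊤ : Submodule R X)).mkQ = 0 := by
      rw [isSMulRegular_iff_right_eq_zero_of_smul] at hwT
      apply hwT
      ext u
      have h3 : lmap a (n+1) (w • (⊤ : Submodule R X)).mkQ (w • u) = 0 := (reg_mid a (n+1) w hwX _).2 ⟨u, rfl⟩
      rw [LinearMap.smul_apply, ← map_smul, LinearMap.comp_apply, h3, map_zero, LinearMap.zero_apply]
    apply hτ
    ext v
    obtain ⟨u, rfl⟩ := hsurj w hwX v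
    exact congrArg (fun f => f u) h2

lemma nonvan [IsAdicComplete (maximalIdeal R) R] (a : Ideal R) (ha : a ≤ maximalIdeal R) (n : ℕ) :
    ∀ (X : Type u) [AddCommGroup X] [Module R X] [Module.Finite R X], 
      Module.supportDim R X = n → (∃ k, maximalIdeal R ^ k ≤ a ⊔ Module.annihilator R X) → Nontrivial (LC a n X) := by
  induction n with
  | zero =>
    intro X _ _ _ hX _
    have hnt : Nontrivial X := by
      by_contra h
      rw [not_nontrivial_iff_subsingleton] at h
      rw [Module.supportDim_eq_bot_of_subsingleton] at hX
      exact absurd hX (WithBot.bot_ne_coe)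
    obtain ⟨j, hj⟩ := pow_of_dim (M := X) (by simpa using hX.le)
    obtain ⟨x, hx⟩ := exists_ne (0 : X)
    obtain ⟨u, rfl⟩ := leps_surj a x j fun r hr => Module.mem_annihilator.1 (hj (Ideal.pow_right_mono ha j hr)) x
    exact ⟨u, 0, fun h => hx (by rw [h, map_zero])⟩
  | succ n ih =>
    intro X _ _ _ hX hk
    obtain ⟨k, hk⟩ := hk
    obtain ⟨j, hj⟩ := gam_kill a X k hk
    have hd : Module.supportDim R (X ⧸ Gam a X) = (n + 1 : ℕ) := le_antisymm 
      ((Module.supportDim_le_of_surjective _ (Submodule.mkQ_surjective _)).trans hX.le) (dim_gam j n X _ hj hX.ge)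
    have := nonvan_step a ha n ih (X ⧸ Gam a X) hd 
      ⟨k, hk.trans (sup_le_sup_left (LinearMap.annihilator_le_of_surjective _ (Submodule.mkQ_surjective _)) _)⟩ (gam_gam a)
    exact (gamEquiv a n).toEquiv.nontrivial

end P15
end LCaux
end

section
open scoped Pointwise
namespace LCaux

section P16
variable {R : Type u} [CommRing R] [IsNoetherianRing R] [IsLocalRing R]
open IsLocalRing

lemma min_of_dim (n : ℕ) (I p : Ideal R) [hp : p.IsPrime] (hI : Module.supportDim R (R ⧸ I) ≤ (n + 1 : ℕ)) (hIp : I ≤ p)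
    (h : ((n + 1 : ℕ) : WithBot ℕ∞) ≤ Module.supportDim R (R ⧸ p)) : p ∈ I.minimalPrimes := by
  refine ⟨⟨hp, hIp⟩, ?_⟩
  rintro q ⟨hq, hIq⟩ hqp
  by_contra hn
  obtain ⟨x, hxp, hxq⟩ := SetLike.not_le_iff_exists.1 hn
  have h1 := Module.supportDim_quotSMulTop_succ_eq_supportDim (reg_quot q x hxq) (le_maximalIdeal hp.ne_top hxp)
  have h2 : Module.supportDim R (R ⧸ q) ≤ (n + 1 : ℕ) := 
    (sdim_ann (by rw [Ideal.annihilator_quotient, Ideal.annihilator_quotient]; exact hIq)).trans hI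
  have h3 := wb_le _ _ (h1 ▸ h2)
  have h4 : Module.supportDim R (R ⧸ p) ≤ Module.supportDim R (QuotSMulTop x (R ⧸ q)) := sdim_ann (by
    rw [Ideal.annihilator_quotient]
    intro r hr
    exact sup_le hqp ((Ideal.span_singleton_le_iff_mem _).2 hxp) (ann_quotSMulTop_mem q x r hr))
  exact (wb_lt_of_le _ _ (h4.trans h3)).not_ge h

variable [IsAdicComplete (maximalIdeal R) R] {M : Type u} [AddCommGroup M] [Module R M] [Module.Finite R M]

lemma main_fwd (a : Ideal R) (n : ℕ) (hd : Module.supportDim R M = (n + 1 : ℕ)) (p : Ideal R) (hp : p ∈ attachedPrimes R (LC a (n+1) M)) :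
    p ∈ associatedPrimes R M ∧ Module.supportDim R (R ⧸ p) = (n + 1 : ℕ) ∧ (a ⊔ p).radical = maximalIdeal R := by
  obtain ⟨hp, K, hK⟩ := hp
  have hann : Module.annihilator R M ≤ p := by
    intro r hr
    rw [hK, Module.mem_annihilator]
    intro x
    obtain ⟨x, rfl⟩ := Submodule.mkQ_surjective _ x
    rw [← map_smul, lc_ann a _ r hr, map_zero]
  have hne : ¬ Subsingleton (LC a (n+1) (M ⧸ p • (⊤ : Submodule R M))) := by
    intro h
    have h1 := ideal_smul_top a (n+1) hd.le p h
    have h2 : K = ⊤ := by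
      rw [eq_top_iff, ← h1, Submodule.smul_le]
      intro r hr x _
      rw [hK, Module.mem_annihilator] at hr
      have := hr (K.mkQ x)
      rwa [← map_smul, Submodule.mkQ_apply, Submodule.Quotient.mk_eq_zero] at this
    apply hp.ne_top
    rw [hK, h2, Module.annihilator_eq_top_iff]
    infer_instance
  have hle : p ≤ Module.annihilator R (M ⧸ p • (⊤ : Submodule R M)) := le_ann_quot _ _
  have hup : Module.supportDim R (R ⧸ p) ≤ (n + 1 : ℕ) := by
    rw [← hd]
    exact sdim_ann (by rwa [Ideal.annihilator_quotient])
  have hlow : ((n + 1 : ℕ) : WithBot ℕ∞) ≤ Module.supportDim R (R ⧸ p) := by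
    by_contra hlt
    exact hne (van a (n+1) _ (lt_of_le_of_lt (sdim_ann (by rwa [Ideal.annihilator_quotient])) (not_le.1 hlt)))
  have hdp := le_antisymm hup hlow
  refine ⟨?_, hdp, ?_⟩
  · apply Module.associatedPrimes.minimalPrimes_annihilator_subset_associatedPrimes R M
    refine min_of_dim n _ p ?_ hann hlow
    rw [Module.supportDim_quotient_eq_ringKrullDim, ← Module.supportDim_eq_ringKrullDim_quotient_annihilator, hd]
  · have hPP : ∀ P : Ideal R, P.IsPrime → a ⊔ p ≤ P → P = maximalIdeal R := by
      intro P hP hle2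
      by_contra hPm
      exact hne (lc_of_quot a (n+1) p hup (hlvt a n p P hup (le_sup_left.trans hle2) (le_sup_right.trans hle2) hPm) hle)
    have htop : a ⊔ p ≠ ⊤ := by
      intro h
      have ha : a = ⊤ := by
        by_contra hat
        exact (maximalIdeal.isMaximal R).ne_top (top_le_iff.1 (h ▸ sup_le (le_maximalIdeal hat) (le_maximalIdeal hp.ne_top)))
      exact hne (lc_top a ha _)
    rw [Ideal.radical_eq_sInf]
    apply le_antisymm
    · exact sInf_le ⟨le_maximalIdeal htop, inferInstance⟩
    · exact le_sInf fun P hP => (hPP P hP.2 hP.1).ge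

lemma main_bwd (a : Ideal R) (n : ℕ) (hd : Module.supportDim R M = (n + 1 : ℕ)) (p : Ideal R) (hp : p ∈ associatedPrimes R M) 
    (hdp : Module.supportDim R (R ⧸ p) = (n + 1 : ℕ)) (hr : (a ⊔ p).radical = maximalIdeal R) : p ∈ attachedPrimes R (LC a (n+1) M) := by
  have hpp : p.IsPrime := hp.isPrime
  have hann : Module.annihilator R M ≤ p := Submodule.annihilator_top (R := R) (M := M) ▸ hp.annihilator_le
  refine ⟨hpp, p • ⊤, ?_⟩
  have ha : a ≤ maximalIdeal R := hr ▸ (le_sup_left.trans Ideal.le_radical)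
  obtain ⟨k, hk⟩ := (a ⊔ p).exists_radical_pow_le_of_fg (IsNoetherian.noetherian _)
  rw [hr] at hk
  have hle : p ≤ Module.annihilator R (M ⧸ p • (⊤ : Submodule R M)) := le_ann_quot _ _
  have hX : Module.annihilator R (M ⧸ p • (⊤ : Submodule R M)) ≤ p := by
    have : (⟨p, hpp⟩ : PrimeSpectrum R) ∈ Module.support R (M ⧸ p • (⊤ : Submodule R M)) := by
      rw [Module.support_quotient]
      exact ⟨Module.mem_support_iff_of_finite.2 hann, by simp⟩
    exact Module.annihilator_le_of_mem_support this
  have hXe := le_antisymm hX hle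
  have hdX : Module.supportDim R (M ⧸ p • (⊤ : Submodule R M)) = (n + 1 : ℕ) := by
    rw [Module.supportDim_eq_ringKrullDim_quotient_annihilator, hXe, ← Module.supportDim_quotient_eq_ringKrullDim, hdp]
  have hnv := nonvan a ha (n+1) (M ⧸ p • (⊤ : Submodule R M)) hdX ⟨k, by rwa [hXe]⟩
  have e : (LC a (n+1) M ⧸ p • (⊤ : Submodule R (LC a (n+1) M))) ≃ₗ[R] LC a (n+1) (M ⧸ p • (⊤ : Submodule R M)) := 
    (Submodule.quotEquivOfEq _ _ (ideal_ker a (n+1) hd.le p).symm).trans 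
      (LinearMap.quotKerEquivOfSurjective _ (rex a (n+1) hd.le _ (Submodule.mkQ_surjective _)))
  rw [e.annihilator_eq]
  apply le_antisymm
  · intro r hr
    exact Module.mem_annihilator.2 fun x => lc_ann a _ r (hle hr) x
  · intro x hx
    by_contra hxp
    refine not_subsingleton (LC a (n+1) (M ⧸ p • (⊤ : Submodule R M))) (subsingleton_of_forall_eq 0 fun u => ?_)
    have : ∃ v, x • v = u := by
      by_cases hxm : x ∈ maximalIdeal R
      · refine elt_smul_top a (n+1) hdX.le x (van a (n+1) _ ?_) u
        have h1 := Module.supportDim_quotSMulTop_succ_eq_supportDim (reg_quot p x hxp) hxm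
        have h2 := wb_le _ _ (h1 ▸ hdp.le)
        refine wb_lt_of_le _ _ (le_trans (sdim_ann ?_) h2)
        intro r hr
        exact ann_quotSMulTop_le p x _ hle (ann_quotSMulTop_mem p x r hr)
      · obtain ⟨v, hv⟩ := (not_not.1 hxm : IsUnit x).exists_right_inv
        exact ⟨v • u, by rw [← mul_smul, hv, one_smul]⟩
    obtain ⟨v, rfl⟩ := this
    exact Module.mem_annihilator.1 hx v

end P16
end LCaux
end

theorem stmt10 (R : Type u) [CommRing R] [IsNoetherianRing R] [IsLocalRing R]
    [IsAdicComplete (IsLocalRing.maximalIdeal R) R]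
    (M : Type u) [AddCommGroup M] [Module R M] [Module.Finite R M]
    (n : ℕ) (hn : 1 ≤ n)
    (hdim : ringKrullDim (R ⧸ Module.annihilator R M) = (n : WithBot (WithTop ℕ)))
    (a : Ideal R) :
    attachedPrimes R ((localCohomology a n).obj (ModuleCat.of R M)) =
      { p ∈ assh R M n | (a ⊔ p).radical = IsLocalRing.maximalIdeal R } := by
  obtain ⟨n, rfl⟩ : ∃ k, n = k + 1 := ⟨n - 1, by omega⟩
  have hd : Module.supportDim R M = (n + 1 : ℕ) := by
    rw [Module.supportDim_eq_ringKrullDim_quotient_annihilator]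
    exact hdim
  ext p
  constructor
  · intro hp
    obtain ⟨h1, h2, h3⟩ := LCaux.main_fwd a n hd p hp
    rw [Module.supportDim_quotient_eq_ringKrullDim] at h2
    exact ⟨⟨h1, h2⟩, h3⟩
  · rintro ⟨⟨h1, h2⟩, h3⟩
    exact LCaux.main_bwd a n hd p h1 ((Module.supportDim_quotient_eq_ringKrullDim p).trans h2) h3

end
end

section
/- Let (R, m) be a complete Noetherian local ring, Q a prime ideal of R with dim(R/Q) ≥ 2, and I an ideal of R with I not contained in Q. Then there exists a prime ideal Q' of R with Q ⊂ Q' (strict inclusion), dim(R/Q') = dim(R/Q) − 1, and I not contained in Q'. -/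
noncomputable section

universe u

lemma aux_lt {A : Type u} [CommRing A] {p q : Ideal A} (hp : p.IsPrime) (h : p < q) :
    ringKrullDim (A ⧸ q) + 1 ≤ ringKrullDim (A ⧸ p) := by
  obtain ⟨z, hzq, hzp⟩ := SetLike.exists_of_lt h
  refine ringKrullDim_succ_le_of_surjective (Ideal.Quotient.factor h.le)
    (Ideal.Quotient.factor_surjective h.le) (r := Ideal.Quotient.mk p z) ?_ ?_
  · rw [mem_nonZeroDivisors_iff_ne_zero]
    rwa [Ne, Ideal.Quotient.eq_zero_iff_mem]
  · rw [Ideal.Quotient.factor_mk, Ideal.Quotient.eq_zero_iff_mem]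
    exact hzq

lemma aux_exists {A : Type u} [CommRing A] (J : Ideal A) (n : ℕ)
    (h : (n : WithBot ℕ∞) ≤ ringKrullDim (A ⧸ J)) :
    ∃ P : Ideal A, P.IsPrime ∧ J ≤ P ∧ (n : WithBot ℕ∞) ≤ ringKrullDim (A ⧸ P) := by
  rw [ringKrullDim_quotient, Order.le_krullDim_iff] at h
  obtain ⟨l, rfl⟩ := h
  refine ⟨l.head.1.asIdeal, l.head.1.2, l.head.2, ?_⟩
  rw [ringKrullDim_quotient, Order.le_krullDim_iff]
  exact ⟨LTSeries.mk l.length (fun i => ⟨(l i).1, l.head_le i⟩)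
    (fun i j hij => l.strictMono hij), rfl⟩

lemma aux_main {A : Type u} [CommRing A] [IsDomain A] [IsNoetherianRing A] [IsLocalRing A]
    (hdim : (2 : WithBot ℕ∞) ≤ ringKrullDim A) (x : A) (hx : x ≠ 0) :
    ∃ P : Ideal A, P.IsPrime ∧ P ≠ ⊥ ∧ ringKrullDim (A ⧸ P) + 1 = ringKrullDim A ∧ x ∉ P := by
  have h0 : ringKrullDim (A ⧸ (⊥ : Ideal A)) = ringKrullDim A :=
    ringKrullDim_eq_of_ringEquiv (RingEquiv.quotientBot A)
  have hm : (2 : ℕ∞) ≤ (IsLocalRing.maximalIdeal A).height := by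
    rw [← IsLocalRing.maximalIdeal_height_eq_ringKrullDim] at hdim
    exact WithBot.coe_le_coe.1 hdim
  have hfin : (insert ⊥ (Ideal.span {x}).minimalPrimes).Finite :=
    ((Ideal.span {x}).finite_minimalPrimes_of_isNoetherianRing A).insert _
  obtain ⟨y, hym, hy⟩ : ∃ y ∈ IsLocalRing.maximalIdeal A,
      ∀ p ∈ insert ⊥ (Ideal.span {x}).minimalPrimes, y ∉ p := by
    by_contra! hcon
    obtain ⟨p, hp, hmp⟩ := ((IsLocalRing.maximalIdeal A).subset_union_prime_finite hfin
      (f := id) 0 0 (by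
        rintro p (rfl | hp) _ _
        · exact Ideal.isPrime_bot
        · exact hp.1.1)).1 (fun y hy => by
          obtain ⟨p, hp, hyp⟩ := hcon y hy
          exact Set.mem_biUnion hp hyp)
    have : p.height ≤ 1 := by
      rcases hp with rfl | hp
      · simp
      · exact Ideal.height_le_one_of_isPrincipal_of_mem_minimalPrimes _ _ hp
    have h2 := (hm.trans (Ideal.height_mono hmp)).trans this
    exact absurd h2 (by decide)
  have hle : ringKrullDim A ≤ ringKrullDim (A ⧸ Ideal.span {y}) + 1 := by
    rw [← IsLocalRing.maximalIdeal_height_eq_ringKrullDim]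
    exact Ideal.height_le_ringKrullDim_quotient_add_one hym
  obtain ⟨d, hd⟩ : ∃ d : ℕ, ringKrullDim A = d := by
    rw [← IsLocalRing.maximalIdeal_height_eq_ringKrullDim]
    obtain ⟨d, hd⟩ := ENat.ne_top_iff_exists.1
      (Ideal.height_ne_top (I := IsLocalRing.maximalIdeal A) (Ideal.IsPrime.ne_top inferInstance))
    exact ⟨d, by rw [← hd]; rfl⟩
  obtain ⟨n, rfl⟩ : ∃ n, d = n + 1 := by
    refine ⟨d - 1, ?_⟩
    rw [hd] at hdim
    have : 2 ≤ d := by exact_mod_cast hdim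
    omega
  have hcancel : ∀ a : WithBot ℕ∞, ((n + 1 : ℕ) : WithBot ℕ∞) ≤ a + 1 → (n : WithBot ℕ∞) ≤ a := by
    intro a ha
    induction a with
    | bot => simp at ha
    | coe a =>
      induction a with
      | top => exact_mod_cast le_top
      | coe a =>
        have : n + 1 ≤ a + 1 := by exact_mod_cast ha
        have : n ≤ a := by omega
        exact_mod_cast this
  obtain ⟨P, hP, hyP, hPn⟩ := aux_exists (Ideal.span {y}) n (hcancel _ (hd ▸ hle))
  rw [Ideal.span_singleton_le_iff_mem] at hyP
  have hPb : P ≠ ⊥ := by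
    rintro rfl
    exact hy ⊥ (Set.mem_insert _ _) hyP
  refine ⟨P, hP, hPb, le_antisymm (h0 ▸ aux_lt Ideal.isPrime_bot (bot_lt_iff_ne_bot.2 hPb)) ?_, ?_⟩
  · rw [hd, Nat.cast_add, Nat.cast_one]
    gcongr
  · intro hxP
    obtain ⟨p, hp, hpP⟩ := Ideal.exists_minimalPrimes_le
      ((Ideal.span_singleton_le_iff_mem P).2 hxP)
    have hxp : x ∈ p := (Ideal.span_singleton_le_iff_mem p).1 hp.1.2
    have h1 := aux_lt Ideal.isPrime_bot (bot_lt_iff_ne_bot.2 (show p ≠ ⊥ by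
      rintro rfl; exact hx hxp))
    have h2 := aux_lt hp.1.1 (lt_of_le_of_ne hpP (by
      rintro rfl; exact hy _ (Set.mem_insert_of_mem _ hp) hyP))
    rw [h0, hd] at h1
    have h3 : (n : WithBot ℕ∞) + 1 + 1 ≤ ((n + 1 : ℕ) : WithBot ℕ∞) := by
      refine le_trans ?_ h1
      gcongr
      refine le_trans ?_ h2
      gcongr
    have : n + 1 + 1 ≤ n + 1 := by exact_mod_cast h3
    omega

theorem stmt11 (R : Type u) [CommRing R] [IsNoetherianRing R] [IsLocalRing R]
    [IsAdicComplete (IsLocalRing.maximalIdeal R) R]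
    (Q : Ideal R) (hQ : Q.IsPrime)
    (hdim : (2 : WithBot (WithTop ℕ)) ≤ ringKrullDim (R ⧸ Q))
    (I : Ideal R) (hI : ¬ I ≤ Q) :
    ∃ Q' : Ideal R, Q'.IsPrime ∧ Q < Q' ∧
      ringKrullDim (R ⧸ Q') + 1 = ringKrullDim (R ⧸ Q) ∧ ¬ I ≤ Q' := by
  obtain ⟨x, hxI, hxQ⟩ := SetLike.not_le_iff_exists.1 hI
  have : IsLocalRing (R ⧸ Q) := IsLocalRing.of_surjective' _ Ideal.Quotient.mk_surjective
  obtain ⟨P, hP, hPb, hd, hxP⟩ := aux_main (A := R ⧸ Q) hdim (Ideal.Quotient.mk Q x)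
    (by rwa [Ne, Ideal.Quotient.eq_zero_iff_mem])
  have hQP : Q ≤ P.comap (Ideal.Quotient.mk Q) := by
    intro z hz
    rw [Ideal.mem_comap, Ideal.Quotient.eq_zero_iff_mem.2 hz]
    exact P.zero_mem
  have hmap : (P.comap (Ideal.Quotient.mk Q)).map (Ideal.Quotient.mk Q) = P :=
    Ideal.map_comap_of_surjective _ Ideal.Quotient.mk_surjective P
  refine ⟨P.comap (Ideal.Quotient.mk Q), inferInstance, lt_of_le_of_ne hQP ?_, ?_,
    fun h => hxP (h hxI)⟩
  · intro h
    apply hPb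
    rw [← hmap, ← h, Ideal.map_quotient_self]
  · rw [← hd, ← ringKrullDim_eq_of_ringEquiv (DoubleQuot.quotQuotEquivQuotOfLE hQP), hmap]

end
end
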